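/- arXiv:2509.16547 — 8 statements merged into one kernel-verified Lean document; each statement's English description precedes it below -/
import Mathlib

section
/- Let ℓ, n be natural numbers, A : Matrix (Fin ℓ) (Fin n) ℝ a matrix, and define A' : Matrix (Fin (ℓ+2)) (Fin (n+1)) ℝ by: A' j k = A j k for j < ℓ and k < n; A' j n = 0 for j < ℓ; A' ℓ k = 0 and A' (ℓ+1) k = 0 for k < n; A' ℓ n = 1 and A' (ℓ+1) n = -1. Then for every function N : (Fin n → ℝ) → ℝ, the total monotonicity condition (∀ x y : Fin n → ℝ, A.mulVec x ≤ A.mulVec y → N x ≤ N y) holds if and only if (∀ x y : Fin n → ℝ, ∀ a a' : ℝ, A'.mulVec (Fin.snoc x a) ≤ A'.mulVec (Fin.snoc y a') → a ≤ N x → a' ≤ N y), where ≤ between vectors is componentwise. -/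
/-- Correctness of the reduction from total monotonicity rules to monotonicity
rules: with `A'` the matrix obtained from `A` by appending a zero column and the
two rows `(0,…,0,1)` and `(0,…,0,-1)`, the function `N` obeys the total
monotonicity rule for `A` iff the extended network `(x,a) ↦ (N x, a)` obeys the
corresponding monotonicity rule for `A'`. -/
theorem total_mono_reduces_to_mono (ℓ n : ℕ) (A : Matrix (Fin ℓ) (Fin n) ℝ)
    (A' : Matrix (Fin (ℓ + 2)) (Fin (n + 1)) ℝ)
    (hA : ∀ (j : Fin (ℓ + 2)) (k : Fin (n + 1)) (hj : (j : ℕ) < ℓ) (hk : (k : ℕ) < n),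
      A' j k = A ⟨j, hj⟩ ⟨k, hk⟩)
    (hcol : ∀ (j : Fin (ℓ + 2)), (j : ℕ) < ℓ → A' j (Fin.last n) = 0)
    (hrow1 : ∀ (k : Fin (n + 1)), (k : ℕ) < n → A' ⟨ℓ, by omega⟩ k = 0)
    (hrow2 : ∀ (k : Fin (n + 1)), (k : ℕ) < n → A' ⟨ℓ + 1, by omega⟩ k = 0)
    (h1 : A' ⟨ℓ, by omega⟩ (Fin.last n) = 1)
    (h2 : A' ⟨ℓ + 1, by omega⟩ (Fin.last n) = -1)
    (N : (Fin n → ℝ) → ℝ) :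
    (∀ x y : Fin n → ℝ, A.mulVec x ≤ A.mulVec y → N x ≤ N y) ↔
      (∀ (x y : Fin n → ℝ) (a a' : ℝ),
        A'.mulVec (Fin.snoc x a) ≤ A'.mulVec (Fin.snoc y a') → a ≤ N x → a' ≤ N y) := by
  have e0 : ∀ (j : Fin (ℓ + 2)) (hj : (j : ℕ) < ℓ) (x : Fin n → ℝ) (a : ℝ),
      A'.mulVec (Fin.snoc x a) j = A.mulVec x ⟨j, hj⟩ := by
    intro j hj x a
    simp only [Matrix.mulVec, dotProduct]
    rw [Fin.sum_univ_castSucc, hcol j hj]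
    simp only [Fin.snoc_castSucc, zero_mul, add_zero]
    refine Finset.sum_congr rfl fun k _ => ?_
    rw [hA j k.castSucc hj k.isLt]
    rfl
  have e1 : ∀ (x : Fin n → ℝ) (a : ℝ),
      A'.mulVec (Fin.snoc x a) ⟨ℓ, by omega⟩ = a := by
    intro x a
    simp only [Matrix.mulVec, dotProduct]
    rw [Fin.sum_univ_castSucc, h1, Finset.sum_eq_zero]
    · simp
    · intro k _
      rw [hrow1 k.castSucc k.isLt, zero_mul]
  have e2 : ∀ (x : Fin n → ℝ) (a : ℝ),
      A'.mulVec (Fin.snoc x a) ⟨ℓ + 1, by omega⟩ = -a := by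
    intro x a
    simp only [Matrix.mulVec, dotProduct]
    rw [Fin.sum_univ_castSucc, h2, Finset.sum_eq_zero]
    · simp
    · intro k _
      rw [hrow2 k.castSucc k.isLt, zero_mul]
  constructor
  · intro H x y a a' h ha
    have hxy : N x ≤ N y := by
      apply H
      intro j
      have hj := h ⟨j, by omega⟩
      rw [e0 _ j.isLt, e0 _ j.isLt] at hj
      exact hj
    have h4 := h ⟨ℓ + 1, by omega⟩
    rw [e2, e2] at h4
    linarith
  · intro H x y h
    refine H x y (N x) (N x) ?_ le_rfl
    intro j
    by_cases hj : (j : ℕ) < ℓ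
    · rw [e0 j hj, e0 j hj]
      exact h _
    · have hc : j = ⟨ℓ, by omega⟩ ∨ j = ⟨ℓ + 1, by omega⟩ := by
        have := j.isLt
        simp only [Fin.ext_iff]
        omega
      rcases hc with hc | hc
      · rw [hc, e1, e1]
      · rw [hc, e2, e2]
end

section
/- Let N : (Fin n → ℝ) → ℝ be continuous, and suppose there exist finitely many affine functions g_1, …, g_p, each of the form g_i x = (∑ j, a_i j * x j) + b_i with all a_i j and b_i rational, such that for every x : Fin n → ℝ there is some i with N x = g_i x. Then N is computed by a ReLU network. -/
/-- `ComputedByReLU n m F` says that `F : (Fin n → ℝ) → (Fin m → ℝ)` can be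
written as a finite composition `L_k ∘ σ ∘ L_{k-1} ∘ ⋯ ∘ σ ∘ L_0`, where each
`L_j` is an affine map with rational matrix and bias, and `σ` applies
`t ↦ max t 0` to every coordinate. -/
inductive ComputedByReLU : (n m : ℕ) → ((Fin n → ℝ) → (Fin m → ℝ)) → Prop
  | affine {n m : ℕ} (W : Matrix (Fin m) (Fin n) ℚ) (b : Fin m → ℚ) :
      ComputedByReLU n m (fun x i => (∑ j, (W i j : ℝ) * x j) + (b i : ℝ))
  | comp {n k m : ℕ} (W : Matrix (Fin k) (Fin n) ℚ) (b : Fin k → ℚ)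
      {F : (Fin k → ℝ) → (Fin m → ℝ)} (hF : ComputedByReLU k m F) :
      ComputedByReLU n m
        (fun x => F (fun i => max ((∑ j, (W i j : ℝ) * x j) + (b i : ℝ)) 0))

/-- Rational affine functional. -/
def IsAff {ι : Type} [Fintype ι] (f : (ι → ℝ) → ℝ) : Prop :=
  ∃ (w : ι → ℚ) (b : ℚ), ∀ x, f x = (∑ j, (w j : ℝ) * x j) + (b : ℝ)

theorem IsAff.coord {ι : Type} [Fintype ι] (i : ι) : IsAff (fun x : ι → ℝ => x i) := by
  classical
  refine ⟨fun j => if j = i then 1 else 0, 0, fun x => ?_⟩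
  simp [apply_ite (Rat.cast : ℚ → ℝ)]

theorem IsAff.const {ι : Type} [Fintype ι] (b : ℚ) : IsAff (fun _ : ι → ℝ => (b : ℝ)) :=
  ⟨fun _ => 0, b, fun x => by simp⟩

theorem IsAff.add {ι : Type} [Fintype ι] {f g : (ι → ℝ) → ℝ} (hf : IsAff f) (hg : IsAff g) :
    IsAff (fun x => f x + g x) := by
  obtain ⟨w, b, h⟩ := hf
  obtain ⟨w', b', h'⟩ := hg
  refine ⟨fun j => w j + w' j, b + b', fun x => ?_⟩
  simp only [h, h', Rat.cast_add, add_mul, Finset.sum_add_distrib]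
  ring

theorem IsAff.smul {ι : Type} [Fintype ι] {f : (ι → ℝ) → ℝ} (c : ℚ) (hf : IsAff f) :
    IsAff (fun x => (c : ℝ) * f x) := by
  obtain ⟨w, b, h⟩ := hf
  refine ⟨fun j => c * w j, c * b, fun x => ?_⟩
  simp only [h, Rat.cast_mul, mul_add, Finset.mul_sum, mul_assoc]

theorem IsAff.neg {ι : Type} [Fintype ι] {f : (ι → ℝ) → ℝ} (hf : IsAff f) :
    IsAff (fun x => - f x) := by
  have h := hf.smul (-1)
  simpa using h

theorem IsAff.sub {ι : Type} [Fintype ι] {f g : (ι → ℝ) → ℝ} (hf : IsAff f) (hg : IsAff g) :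
    IsAff (fun x => f x - g x) := by
  simpa [sub_eq_add_neg] using hf.add hg.neg

theorem IsAff.sum {ι κ : Type} [Fintype ι] (s : Finset κ) {f : κ → (ι → ℝ) → ℝ}
    (hf : ∀ k, IsAff (f k)) : IsAff (fun x => ∑ k ∈ s, f k x) := by
  classical
  induction s using Finset.induction_on with
  | empty => simpa using IsAff.const (ι := ι) 0
  | insert a s ha ih =>
    simp only [Finset.sum_insert ha]
    exact (hf a).add ih

theorem IsAff.comp {ι κ : Type} [Fintype ι] [Fintype κ] {f : (κ → ℝ) → ℝ} (hf : IsAff f)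
    {T : (ι → ℝ) → κ → ℝ} (hT : ∀ k, IsAff (fun x => T x k)) : IsAff (fun x => f (T x)) := by
  obtain ⟨w, b, h⟩ := hf
  simp only [h]
  exact (IsAff.sum _ fun k => (hT k).smul (w k)).add (IsAff.const b)

/-- ReLU networks with arbitrary finite index types. -/
inductive RR : (ι κ : Type) → [Fintype ι] → [Fintype κ] → ((ι → ℝ) → (κ → ℝ)) → Prop
  | affine {ι κ : Type} [Fintype ι] [Fintype κ] (F : (ι → ℝ) → (κ → ℝ))
      (h : ∀ k, IsAff (fun x => F x k)) : RR ι κ F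
  | comp {ι μ κ : Type} [Fintype ι] [Fintype μ] [Fintype κ] (L : (ι → ℝ) → (μ → ℝ))
      (h : ∀ k, IsAff (fun x => L x k)) (F : (μ → ℝ) → (κ → ℝ)) (hF : RR μ κ F) :
      RR ι κ (fun x => F (fun i => max (L x i) 0))

theorem RR.toComputed {ι κ : Type} [iι : Fintype ι] [iκ : Fintype κ] {F : (ι → ℝ) → (κ → ℝ)}
    (h : RR ι κ F) : ∀ (n m : ℕ) (e : Fin n ≃ ι) (e' : Fin m ≃ κ),
      ComputedByReLU n m (fun x i => F (fun j => x (e.symm j)) (e' i)) := by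
  induction h with
  | affine F h =>
    intro n m e e'
    choose w b hw using h
    have := ComputedByReLU.affine (n := n) (m := m) (fun i j => w (e' i) (e j)) (fun i => b (e' i))
    convert this using 3 with x i
    refine (hw _ _).trans ?_
    rw [← e.sum_comp]
    simp
  | @comp ι μ κ _ _ _ L h F hF ih =>
    intro n m e e'
    choose w b hw using h
    let q := Fintype.equivFin μ
    have := ComputedByReLU.comp (n := n) (m := m) (fun i j => w (q.symm i) (e j))
      (fun i => b (q.symm i)) (ih _ m q.symm e')
    convert this using 6 with x i j
    refine (hw _ _).trans ?_
    rw [← e.sum_comp]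
    simp

theorem RR.precomp {ι μ κ : Type} [Fintype ι] [Fintype μ] [Fintype κ]
    {G : (μ → ℝ) → (κ → ℝ)} (hG : RR μ κ G) {T : (ι → ℝ) → μ → ℝ}
    (hT : ∀ k, IsAff (fun x => T x k)) : RR ι κ (fun x => G (T x)) := by
  cases hG with
  | affine _ h => exact RR.affine _ fun k => (h k).comp hT
  | comp L h F hF => exact RR.comp (fun x => L (T x)) (fun k => (h k).comp hT) F hF

theorem RR.trans {ι μ κ : Type} [Fintype ι] [Fintype μ] [Fintype κ]
    {F : (ι → ℝ) → (μ → ℝ)} (hF : RR ι μ F) {G : (μ → ℝ) → (κ → ℝ)} (hG : RR μ κ G) :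
    RR ι κ (fun x => G (F x)) := by
  induction hF with
  | affine F h => exact hG.precomp h
  | comp L h F hF ih => exact RR.comp L h (fun z => G (F z)) (ih hG)

theorem RR.pairAff {μ κ : Type} [Fintype μ] [Fintype κ]
    {G : (μ → ℝ) → (κ → ℝ)} (hG : RR μ κ G) : ∀ {ι ν : Type} [Fintype ι] [Fintype ν]
    (T : (ι → ℝ) → μ → ℝ) (_ : ∀ k, IsAff (fun x => T x k))
    (A : (ι → ℝ) → ν → ℝ) (_ : ∀ k, IsAff (fun x => A x k)),
    RR ι (ν ⊕ κ) (fun x => Sum.elim (A x) (G (T x))) := by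
  induction hG with
  | affine G h =>
    intro ι ν _ _ T hT A hA
    refine RR.affine _ ?_
    rintro (k | k)
    · exact hA k
    · exact (h k).comp hT
  | @comp μ' μ κ _ _ _ L h G hG ih =>
    intro ι ν _ _ T hT A hA
    have h1 := ih (ι := μ ⊕ (ν ⊕ ν)) (ν := ν) (fun z i => z (Sum.inl i))
      (fun k => IsAff.coord _)
      (fun z i => z (Sum.inr (Sum.inl i)) - z (Sum.inr (Sum.inr i)))
      (fun k => (IsAff.coord _).sub (IsAff.coord _))
    have h2 := RR.comp (ι := ι)
      (fun x => Sum.elim (L (T x)) (Sum.elim (A x) (fun i => - A x i))) (by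
        rintro (k | k | k)
        · exact (h k).comp hT
        · exact hA k
        · exact (hA k).neg) _ h1
    convert h2 using 3 with x
    swap
    · rfl
    ext i
    simp only [Sum.elim_inr, Sum.elim_inl]
    rcases le_total (A x i) 0 with h | h
    · rw [max_eq_right h, max_eq_left (by linarith)]; ring
    · rw [max_eq_left h, max_eq_right (by linarith)]; ring

theorem RR.pair {ι μ κ : Type} [Fintype ι] [Fintype μ] [Fintype κ]
    {F : (ι → ℝ) → (μ → ℝ)} (hF : RR ι μ F) {G : (ι → ℝ) → (κ → ℝ)} (hG : RR ι κ G) :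
    RR ι (κ ⊕ μ) (fun x => Sum.elim (G x) (F x)) := by
  have h1 := hG.pairAff (ι := ι) (fun x => x) IsAff.coord (fun x => x) IsAff.coord
  have h2 := hF.pairAff (ι := ι ⊕ κ) (fun z i => z (Sum.inl i)) (fun _ => IsAff.coord _)
    (fun z i => z (Sum.inr i)) (fun _ => IsAff.coord _)
  exact h1.trans h2

/-- Scalar functions computed by a network. -/
def Sc {n : ℕ} (f : (Fin n → ℝ) → ℝ) : Prop := RR (Fin n) Unit (fun x _ => f x)

theorem Sc.sup {n : ℕ} {f g : (Fin n → ℝ) → ℝ} (hf : Sc f) (hg : Sc g) : Sc (f ⊔ g) := by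
  have h1 := RR.pair hf hg
  have h2 : RR (Unit ⊕ Unit) Unit
      (fun y _ => (max (y (Sum.inr ()) - y (Sum.inl ())) 0) + (max (y (Sum.inl ())) 0)
        - (max (- y (Sum.inl ())) 0)) :=
    RR.comp (μ := Fin 3) (fun y => ![y (Sum.inr ()) - y (Sum.inl ()), y (Sum.inl ()),
      - y (Sum.inl ())]) (by
        intro k
        fin_cases k
        · exact (IsAff.coord _).sub (IsAff.coord _)
        · exact IsAff.coord _
        · exact (IsAff.coord _).neg)
      (fun z _ => z 0 + z 1 - z 2)
      (RR.affine _ fun _ => ((IsAff.coord _).add (IsAff.coord _)).sub (IsAff.coord _))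
  have h3 := h1.trans h2
  unfold Sc
  convert h3 using 3 with x
  simp only [Sum.elim_inr, Sum.elim_inl, Pi.sup_apply]
  rcases le_total (f x) (g x) with h | h <;> rcases le_total (g x) 0 with h' | h'
  · rw [sup_eq_right.2 h, max_eq_right (by linarith), max_eq_right h', max_eq_left (by linarith)]
    ring
  · rw [sup_eq_right.2 h, max_eq_right (by linarith), max_eq_left h', max_eq_right (by linarith)]
    ring
  · rw [sup_eq_left.2 h, max_eq_left (by linarith), max_eq_right h', max_eq_left (by linarith)]
    ring
  · rw [sup_eq_left.2 h, max_eq_left (by linarith), max_eq_left h', max_eq_right (by linarith)]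
    ring

theorem Sc.neg {n : ℕ} {f : (Fin n → ℝ) → ℝ} (hf : Sc f) : Sc (-f) :=
  RR.trans hf (G := fun y i => - y i) (RR.affine _ fun _ => (IsAff.coord _).neg)

theorem Sc.inf {n : ℕ} {f g : (Fin n → ℝ) → ℝ} (hf : Sc f) (hg : Sc g) : Sc (f ⊓ g) := by
  have h := (hf.neg.sup hg.neg).neg
  rwa [neg_sup, neg_neg, neg_neg] at h

theorem key1 {ι : Type} [Finite ι] (k : ℝ → ℝ) (hk : Continuous k) (h0 : k 0 = 0) (h1 : k 1 = 0)
    (α β : ι → ℝ) (h : ∀ t, ∃ i, k t = α i + β i * t) : ∃ i, 0 ≤ α i ∧ α i + β i ≤ 0 := by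
  by_contra! hcon
  have hslope : ∀ t ∈ Set.Icc (0 : ℝ) 1, ∀ i, α i + β i * t = 0 → 0 < β i := by
    intro t ht i hi
    by_contra! hb
    have := hcon i (by nlinarith [ht.1])
    nlinarith [ht.2]
  have hloc : ∀ t ∈ Set.Icc (0 : ℝ) 1, k t = 0 →
      ∀ᶠ s in nhds t, ∃ i, 0 < β i ∧ k s = β i * (s - t) := by
    intro t ht hkt
    have : ∀ i, ∀ᶠ s in nhds t, k s = α i + β i * s → α i + β i * t = 0 := by
      intro i
      by_cases hi : α i + β i * t = 0
      · exact Filter.Eventually.of_forall fun _ _ => hi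
      · have hc : Continuous fun s => k s - (α i + β i * s) := by fun_prop
        have : ∀ᶠ s in nhds t, k s - (α i + β i * s) ≠ 0 :=
          hc.continuousAt.eventually_ne (by rw [hkt, zero_sub]; exact neg_ne_zero.2 hi)
        filter_upwards [this] with s hs hs'
        exact absurd (sub_eq_zero.2 hs') hs
    filter_upwards [Filter.eventually_all.2 this] with s hs
    obtain ⟨i, hi⟩ := h s
    have := hs i hi
    exact ⟨i, hslope t ht i this, by rw [hi]; linarith⟩
  have hpos : Set.Icc (0 : ℝ) 1 ⊆ {t | 0 ≤ k t} := by
    apply IsClosed.Icc_subset_of_forall_exists_gt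
    · exact (isClosed_le continuous_const hk).inter isClosed_Icc
    · simp [h0]
    · rintro x ⟨hx, hx0, hx1⟩ y hy
      have hev : ∀ᶠ s in nhdsWithin x (Set.Ioi x), 0 ≤ k s := by
        rcases (show 0 ≤ k x from hx).eq_or_lt with hx | hx
        · filter_upwards [nhdsWithin_le_nhds (hloc x ⟨hx0, hx1.le⟩ hx.symm),
            self_mem_nhdsWithin] with s ⟨i, hb, hi⟩ hs
          rw [hi]
          exact mul_nonneg hb.le (sub_nonneg.2 (le_of_lt hs))
        · filter_upwards [nhdsWithin_le_nhds (hk.continuousAt.eventually (lt_mem_nhds hx))]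
            with s hs using le_of_lt hs
      obtain ⟨s, hs, hs'⟩ := (hev.and (Ioc_mem_nhdsGT hy)).exists
      exact ⟨s, hs, hs'⟩
  have hev := hloc 1 (by simp) h1
  obtain ⟨s, ⟨i, hb, hi⟩, hs⟩ := ((hev.filter_mono nhdsWithin_le_nhds).and
    (Ico_mem_nhdsLT (zero_lt_one : (0 : ℝ) < 1))).exists
  have := hpos ⟨hs.1, hs.2.le⟩
  simp only [Set.mem_ofPred_eq, hi] at this
  nlinarith [hs.2]

/-- Every continuous piecewise-linear function with rational coefficients is
computed by a ReLU network. -/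
theorem continuous_piecewise_linear_computed_by_relu (n : ℕ)
    (N : (Fin n → ℝ) → ℝ) (hN : Continuous N)
    (p : ℕ) (a : Fin p → Fin n → ℚ) (b : Fin p → ℚ)
    (hpl : ∀ x : Fin n → ℝ, ∃ i : Fin p, N x = (∑ j, (a i j : ℝ) * x j) + (b i : ℝ)) :
    ∃ F : (Fin n → ℝ) → (Fin 1 → ℝ), ComputedByReLU n 1 F ∧ ∀ x, F x 0 = N x := by
  classical
  let g : Fin p → (Fin n → ℝ) → ℝ := fun i x => (∑ j, (a i j : ℝ) * x j) + (b i : ℝ)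
  have hg : ∀ i, Sc (g i) := fun i => RR.affine _ fun _ => ⟨a i, b i, fun _ => rfl⟩
  have key : ∀ y x : Fin n → ℝ, ∃ i, N y ≤ g i y ∧ g i x ≤ N x := by
    intro y x
    have hline : ∀ i t, g i (fun j => y j + t * (x j - y j)) = g i y + t * (g i x - g i y) := by
      intro i t
      have : ∑ j, (a i j : ℝ) * (y j + t * (x j - y j)) = (∑ j, (a i j : ℝ) * y j) +
          t * ((∑ j, (a i j : ℝ) * x j) - ∑ j, (a i j : ℝ) * y j) := by
        rw [← Finset.sum_sub_distrib, Finset.mul_sum, ← Finset.sum_add_distrib]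
        exact Finset.sum_congr rfl fun j _ => by ring
      simp only [g, this]
      ring
    obtain ⟨i, h1, h2⟩ := key1 (ι := Fin p)
      (fun t => N (fun j => y j + t * (x j - y j)) - (N y + t * (N x - N y)))
      (by fun_prop) (by simp) (by simp)
      (fun i => g i y - N y) (fun i => (g i x - g i y) - (N x - N y)) (by
        intro t
        obtain ⟨i, hi⟩ := hpl (fun j => y j + t * (x j - y j))
        refine ⟨i, ?_⟩
        have h2 := hline i t
        have hi' : N (fun j => y j + t * (x j - y j)) = g i (fun j => y j + t * (x j - y j)) := hi
        simp only [hi', h2]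
        ring)
    exact ⟨i, by linarith, by linarith⟩
  let S : (Fin n → ℝ) → Finset (Fin p) := fun y => Finset.univ.filter fun i => N y ≤ g i y
  have hS : ∀ y, (S y).Nonempty := fun y => by
    obtain ⟨i, hi, _⟩ := key y y
    exact ⟨i, by simp [S, hi]⟩
  let m : Finset (Fin p) → (Fin n → ℝ) → ℝ := fun s => if h : s.Nonempty then s.inf' h g else g (hS 0).choose
  have hm : ∀ s, Sc (m s) := by
    intro s
    by_cases h : s.Nonempty
    · simp only [m, dif_pos h]
      exact Finset.inf'_induction h g (p := Sc) (fun _ h1 _ h2 => h1.inf h2) fun i _ => hg i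
    · simp only [m, dif_neg h]
      exact hg _
  let U : Finset (Finset (Fin p)) := Finset.univ.filter fun s => ∃ y, s = S y
  have hU : U.Nonempty := ⟨S 0, by simp only [U, Finset.mem_filter_univ]; exact ⟨0, rfl⟩⟩
  have hfin : Sc (U.sup' hU m) :=
    Finset.sup'_induction hU m (p := Sc) (fun _ h1 _ h2 => h1.sup h2) fun i _ => hm i
  have heq : ∀ x, U.sup' hU m x = N x := by
    intro x
    rw [Finset.sup'_apply]
    apply le_antisymm
    · apply Finset.sup'_le
      intro s hs
      simp only [U, Finset.mem_filter_univ] at hs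
      obtain ⟨y, rfl⟩ := hs
      simp only [m, dif_pos (hS y), Finset.inf'_apply]
      obtain ⟨i, h1, h2⟩ := key y x
      exact (Finset.inf'_le (fun i => g i x) (by simp [S, h1])).trans h2
    · refine le_trans ?_ (Finset.le_sup' (fun s => m s x) (b := S x)
        (by simp only [U, Finset.mem_filter_univ]; exact ⟨x, rfl⟩))
      simp only [m, dif_pos (hS x), Finset.inf'_apply]
      apply Finset.le_inf'
      intro i hi
      simpa [S] using hi
  exact ⟨_, RR.toComputed hfin n 1 (Equiv.refl _) (Equiv.ofUnique _ _), fun x => heq x⟩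
end

section
/- Let (x_1, y_1), …, (x_p, y_p) be finitely many pairs with x_i : Fin n → ℚ and y_i : Fin m → ℚ, such that the inputs are pairwise distinct (i ≠ j → x_i ≠ x_j). Then there exists a function F : (Fin n → ℝ) → (Fin m → ℝ) computed by a ReLU network such that F (x_i viewed in ℝ) = (y_i viewed in ℝ) for every i. -/
/-- Finite interpolation by ReLU networks: any finitely many data points with
rational coordinates and pairwise distinct inputs are interpolated by a
function computed by a ReLU network. -/
theorem relu_network_interpolation (n m p : ℕ)
    (x : Fin p → Fin n → ℚ) (y : Fin p → Fin m → ℚ)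
    (hx : ∀ i j : Fin p, i ≠ j → x i ≠ x j) :
    ∃ F : (Fin n → ℝ) → (Fin m → ℝ), ComputedByReLU n m F ∧
      ∀ i : Fin p, F (fun j => (x i j : ℝ)) = fun j => (y i j : ℝ) := by
  classical
  let e : Fin (Fintype.card (Fin p × Fin n × Bool)) ≃ Fin p × Fin n × Bool :=
    (Fintype.equivFin _).symm
  let sg : Bool → ℚ := fun c => if c then 1 else -1
  let d : Fin p → Fin p → ℚ := fun i k => ∑ j, |x k j - x i j|
  let C : Fin p → ℚ := fun i => ∑ k, (d i k)⁻¹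
  have hd0 : ∀ i k, 0 ≤ d i k := fun i k => Finset.sum_nonneg fun j _ => abs_nonneg _
  have hC : ∀ i k, i ≠ k → 1 ≤ C i * d i k := by
    intro i k hik
    have hpos : 0 < d i k := by
      refine lt_of_le_of_ne (hd0 i k) fun h => hx i k hik ?_
      have h2 := (Finset.sum_eq_zero_iff_of_nonneg
        (fun j _ => abs_nonneg (x k j - x i j))).1 h.symm
      funext j
      have := abs_eq_zero.1 (h2 j (Finset.mem_univ j))
      linarith
    have h1 : (d i k)⁻¹ ≤ C i :=
      Finset.single_le_sum (f := fun k => (d i k)⁻¹)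
        (fun k _ => inv_nonneg.2 (hd0 i k)) (Finset.mem_univ k)
    calc (1 : ℚ) = (d i k)⁻¹ * d i k := (inv_mul_cancel₀ hpos.ne').symm
      _ ≤ C i * d i k := mul_le_mul_of_nonneg_right h1 hpos.le
  let W0 : Matrix (Fin (Fintype.card (Fin p × Fin n × Bool))) (Fin n) ℚ :=
    fun r j => if j = (e r).2.1 then sg (e r).2.2 else 0
  let b0 : Fin (Fintype.card (Fin p × Fin n × Bool)) → ℚ :=
    fun r => - (sg (e r).2.2 * x (e r).1 (e r).2.1)
  let W1 : Matrix (Fin p) (Fin (Fintype.card (Fin p × Fin n × Bool))) ℚ :=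
    fun i r => if (e r).1 = i then - C i else 0
  let b1 : Fin p → ℚ := fun _ => 1
  let W2 : Matrix (Fin m) (Fin p) ℚ := fun l i => y i l
  refine ⟨_, .comp W0 b0 (.comp W1 b1 (.affine W2 (fun _ => 0))), ?_⟩
  intro k
  have h0 : ∀ r, max ((∑ j, (W0 r j : ℝ) * (x k j : ℝ)) + (b0 r : ℝ)) 0 =
      ((max (sg (e r).2.2 * (x k (e r).2.1 - x (e r).1 (e r).2.1)) 0 : ℚ) : ℝ) := by
    intro r
    have : ∑ j, (W0 r j : ℝ) * (x k j : ℝ) = sg (e r).2.2 * x k (e r).2.1 := by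
      rw [Finset.sum_eq_single (e r).2.1]
      · simp [W0]
      · intro j _ h
        simp [W0, h]
      · simp
    rw [this]
    push_cast
    congr 1
    simp only [b0]
    push_cast
    ring
  have h1 : ∀ i, max ((∑ r, (W1 i r : ℝ) *
      ((max (sg (e r).2.2 * (x k (e r).2.1 - x (e r).1 (e r).2.1)) 0 : ℚ) : ℝ))
        + (b1 i : ℝ)) 0 = if i = k then (1 : ℝ) else 0 := by
    intro i
    have hs : ∑ r, W1 i r * max (sg (e r).2.2 * (x k (e r).2.1 - x (e r).1 (e r).2.1)) 0
        = - (C i * d i k) := by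
      have := Equiv.sum_comp e (fun s : Fin p × Fin n × Bool =>
        (if s.1 = i then - C i else 0) * max (sg s.2.2 * (x k s.2.1 - x s.1 s.2.1)) 0)
      refine this.trans ?_
      rw [Fintype.sum_prod_type, Finset.sum_eq_single i]
      · rw [Fintype.sum_prod_type]
        simp only [if_true, d, Finset.mul_sum, ← Finset.sum_neg_distrib]
        refine Finset.sum_congr rfl fun j _ => ?_
        simp only [Fintype.sum_bool, sg]
        rcases le_total 0 (x k j - x i j) with h | h
        · rw [abs_of_nonneg h]
          simp [max_eq_left h]
          grind
        · rw [abs_of_nonpos h]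
          simp
          grind
      · intro i' _ h
        simp [h]
      · simp
    have hs' : max ((∑ r, W1 i r *
        max (sg (e r).2.2 * (x k (e r).2.1 - x (e r).1 (e r).2.1)) 0) + b1 i) 0
        = if i = k then (1 : ℚ) else 0 := by
      rw [hs]
      split_ifs with h
      · subst h
        simp [d, b1]
      · have := hC i k h
        apply max_eq_right
        simp only [b1]
        linarith
    have hc := congrArg (fun q : ℚ => (q : ℝ)) hs'
    simp only [apply_ite (fun q : ℚ => (q : ℝ)), Rat.cast_one, Rat.cast_zero] at hc
    rw [← hc]
    push_cast
    rfl
  funext l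
  simp only [h0, h1]
  simp [W2]
end

section
/- Let S_1, …, S_k ⊆ (Fin n → ℝ) be nonempty semi-linear sets for which there exists a constant c > 0 such that for all i ≠ j, all x ∈ S_i and all y ∈ S_j, dist x y ≥ c, and let y_1, …, y_k : Fin m → ℚ be arbitrary chosen target values. Then there exists a function F : (Fin n → ℝ) → (Fin m → ℝ) computed by a ReLU network such that for every i and every x ∈ S_i, F x = y_i (viewed in ℝ). -/
/-- A set `S ⊆ (Fin n → ℝ)` is semi-linear if it is a finite union of finite
intersections of (weak or strict) half-spaces with rational coefficients. -/
def IsSemiLinear {n : ℕ} (S : Set (Fin n → ℝ)) : Prop :=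
  ∃ (K : ℕ) (P : Fin K → ℕ)
    (a : (i : Fin K) → Fin (P i) → Fin n → ℚ)
    (b : (i : Fin K) → Fin (P i) → ℚ)
    (strict : (i : Fin K) → Fin (P i) → Bool),
    S = ⋃ i, ⋂ j,
      {x : Fin n → ℝ |
        if strict i j then (∑ t, (a i j t : ℝ) * x t) < (b i j : ℝ)
        else (∑ t, (a i j t : ℝ) * x t) ≤ (b i j : ℝ)}

theorem aux_between (s t : Finset ℚ) (h : ∀ x ∈ s, ∀ y ∈ t, x ≤ y) :
    ∃ z, (∀ x ∈ s, x ≤ z) ∧ (∀ y ∈ t, z ≤ y) := by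
  by_cases hs : s.Nonempty
  · exact ⟨s.max' hs, fun x hx => s.le_max' x hx, fun y hy => h _ (s.max'_mem hs) y hy⟩
  · rw [Finset.not_nonempty_iff_eq_empty] at hs
    subst hs
    by_cases ht : t.Nonempty
    · exact ⟨t.min' ht, by simp, fun y hy => t.min'_le y hy⟩
    · rw [Finset.not_nonempty_iff_eq_empty] at ht
      subst ht
      exact ⟨0, by simp, by simp⟩

theorem aux_fm : ∀ (n : ℕ) (T : Finset ((Fin n → ℚ) × ℚ)) (C : Set ((Fin n → ℚ) × ℚ)),
    (∀ p ∈ C, ∀ q ∈ C, p + q ∈ C) → (∀ r : ℚ, 0 < r → ∀ p ∈ C, r • p ∈ C) →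
    (∀ t ∈ T, t ∈ C) → (¬ ∃ x : Fin n → ℚ, ∀ t ∈ T, ∑ i, t.1 i * x i ≤ t.2) →
    ∃ b : ℚ, b < 0 ∧ ((0 : Fin n → ℚ), b) ∈ C := by
  classical
  intro n
  induction n with
  | zero =>
    intro T C hadd hsmul hT hinf
    push Not at hinf
    obtain ⟨t, ht, hlt⟩ := hinf 0
    refine ⟨t.2, by simpa using hlt, ?_⟩
    have : ((0 : Fin 0 → ℚ), t.2) = t := Prod.ext (Subsingleton.elim _ _) rfl
    rw [this]; exact hT t ht
  | succ n ih =>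
    intro T C hadd hsmul hT hinf
    let D : ((Fin (n+1) → ℚ) × ℚ) → ((Fin n → ℚ) × ℚ) := fun t => (Fin.tail t.1, t.2)
    let cmb : ((Fin (n+1) → ℚ) × ℚ) → ((Fin (n+1) → ℚ) × ℚ) → ((Fin (n+1) → ℚ) × ℚ) :=
      fun p q => (p.1 0) • q + (-(q.1 0)) • p
    let Z := T.filter (fun t => t.1 0 = 0)
    let Po := T.filter (fun t => 0 < t.1 0)
    let Ne := T.filter (fun t => t.1 0 < 0)
    let T' := Z.image D ∪ (Po ×ˢ Ne).image (fun pq => D (cmb pq.1 pq.2))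
    let C' : Set ((Fin n → ℚ) × ℚ) := {t | ((Fin.cons 0 t.1 : Fin (n+1) → ℚ), t.2) ∈ C}
    have hD : ∀ t : ((Fin (n+1) → ℚ) × ℚ), t.1 0 = 0 → t ∈ C → D t ∈ C' := by
      intro t h0 ht
      have : ((Fin.cons 0 (D t).1 : Fin (n+1) → ℚ), (D t).2) = t := by
        refine Prod.ext ?_ rfl
        show (Fin.cons 0 (Fin.tail t.1) : Fin (n+1) → ℚ) = t.1
        rw [← h0]; exact Fin.cons_self_tail t.1
      show _ ∈ C
      rw [this]; exact ht
    have key := ih T' C' ?_ ?_ ?_ ?_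
    · obtain ⟨b, hb, hC⟩ := key
      refine ⟨b, hb, ?_⟩
      have h0 : (Fin.cons 0 (0 : Fin n → ℚ) : Fin (n+1) → ℚ) = 0 := by
        ext i; refine Fin.cases ?_ (fun j => ?_) i <;> simp
      have hC : ((Fin.cons 0 (0 : Fin n → ℚ) : Fin (n+1) → ℚ), b) ∈ C := hC
      rwa [h0] at hC
    · intro p hp q hq
      have := hadd _ hp _ hq
      have e : ((Fin.cons 0 (p+q).1 : Fin (n+1) → ℚ), (p+q).2) =
        ((Fin.cons 0 p.1 : Fin (n+1) → ℚ), p.2) + ((Fin.cons 0 q.1 : Fin (n+1) → ℚ), q.2) := by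
        refine Prod.ext ?_ rfl
        ext i; refine Fin.cases ?_ (fun j => ?_) i <;> simp
      show _ ∈ C
      rw [e]; exact this
    · intro r hr p hp
      have := hsmul r hr _ hp
      have e : ((Fin.cons 0 (r • p).1 : Fin (n+1) → ℚ), (r • p).2) =
        r • ((Fin.cons 0 p.1 : Fin (n+1) → ℚ), p.2) := by
        refine Prod.ext ?_ rfl
        ext i; refine Fin.cases ?_ (fun j => ?_) i <;> simp
      show _ ∈ C
      rw [e]; exact this
    · intro t ht
      rcases Finset.mem_union.1 ht with h | h
      · obtain ⟨u, hu, rfl⟩ := Finset.mem_image.1 h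
        obtain ⟨hu1, hu2⟩ := Finset.mem_filter.1 hu
        exact hD u hu2 (hT u hu1)
      · obtain ⟨⟨p, q⟩, hu, rfl⟩ := Finset.mem_image.1 h
        obtain ⟨hp, hq⟩ := Finset.mem_product.1 hu
        obtain ⟨hp1, hp2⟩ := Finset.mem_filter.1 hp
        obtain ⟨hq1, hq2⟩ := Finset.mem_filter.1 hq
        refine hD _ ?_ ?_
        · simp [cmb]; ring
        · exact hadd _ (hsmul _ hp2 _ (hT _ hq1)) _ (hsmul _ (by simpa using hq2) _ (hT _ hp1))
    · rintro ⟨x, hx⟩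
      apply hinf
      let val : ((Fin (n+1) → ℚ) × ℚ) → ℚ :=
        fun t => (t.2 - ∑ i, t.1 (Fin.succ i) * x i) / t.1 0
      obtain ⟨z, hz1, hz2⟩ := aux_between (Ne.image val) (Po.image val) (by
        intro a ha b hb
        obtain ⟨q, hq, rfl⟩ := Finset.mem_image.1 ha
        obtain ⟨p, hp, rfl⟩ := Finset.mem_image.1 hb
        have hm : D (cmb p q) ∈ T' := Finset.mem_union_right _
          (Finset.mem_image.2 ⟨(p, q), Finset.mem_product.2 ⟨hp, hq⟩, rfl⟩)
        have h := hx _ hm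
        have hp2 := (Finset.mem_filter.1 hp).2
        have hq2 := (Finset.mem_filter.1 hq).2
        have e : ∑ i, (D (cmb p q)).1 i * x i =
          p.1 0 * ∑ i, q.1 (Fin.succ i) * x i - q.1 0 * ∑ i, p.1 (Fin.succ i) * x i := by
          rw [Finset.mul_sum, Finset.mul_sum, ← Finset.sum_sub_distrib]
          refine Finset.sum_congr rfl fun i _ => ?_
          simp [D, cmb, Fin.tail]; ring
        rw [e] at h
        have e2 : (D (cmb p q)).2 = p.1 0 * q.2 - q.1 0 * p.2 := by
          simp [D, cmb]; ring
        rw [e2] at h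
        simp only [val]
        rw [le_div_iff₀ hp2, div_mul_eq_mul_div, div_le_iff_of_neg hq2]
        linarith)
      refine ⟨Fin.cons z x, fun t ht => ?_⟩
      rw [Fin.sum_univ_succ]
      simp only [Fin.cons_zero, Fin.cons_succ]
      rcases lt_trichotomy (t.1 0) 0 with h | h | h
      · have := hz1 (val t) (Finset.mem_image_of_mem _ (Finset.mem_filter.2 ⟨ht, h⟩))
        simp only [val] at this
        rw [div_le_iff_of_neg h] at this
        linarith
      · have := hx (D t) (Finset.mem_union_left _ (Finset.mem_image_of_mem _ (Finset.mem_filter.2 ⟨ht, h⟩)))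
        simp only [D, Fin.tail] at this
        rw [h]; linarith
      · have := hz2 (val t) (Finset.mem_image_of_mem _ (Finset.mem_filter.2 ⟨ht, h⟩))
        simp only [val] at this
        rw [le_div_iff₀ h] at this
        linarith

def auxHS {n : ℕ} (a : Fin n → ℚ) (b : ℚ) (s : Bool) : Set (Fin n → ℝ) :=
  {x : Fin n → ℝ | if s then (∑ t, (a t : ℝ) * x t) < (b : ℝ) else (∑ t, (a t : ℝ) * x t) ≤ (b : ℝ)}

theorem auxHS_le {n : ℕ} {a : Fin n → ℚ} {b : ℚ} {s : Bool} {x : Fin n → ℝ} (h : x ∈ auxHS a b s) :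
    (∑ t, (a t : ℝ) * x t) ≤ (b : ℝ) := by
  cases s
  · simpa [auxHS] using h
  · have : (∑ t, (a t : ℝ) * x t) < (b : ℝ) := by simpa [auxHS] using h
    exact this.le

theorem auxHS_conv {n : ℕ} {a : Fin n → ℚ} {b : ℚ} {s : Bool} {x p : Fin n → ℝ}
    (hp : p ∈ auxHS a b s) (hx : (∑ t, (a t : ℝ) * x t) ≤ (b : ℝ)) (r : ℝ) (h0 : 0 < r) (h1 : r ≤ 1) :
    (x + r • (p - x)) ∈ auxHS a b s := by
  have e : ∑ t, (a t : ℝ) * (x + r • (p - x)) t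
      = (1 - r) * ∑ t, (a t : ℝ) * x t + r * ∑ t, (a t : ℝ) * p t := by
    rw [Finset.mul_sum, Finset.mul_sum, ← Finset.sum_add_distrib]
    refine Finset.sum_congr rfl fun i _ => ?_
    simp; ring
  cases s
  · have hp : (∑ t, (a t : ℝ) * p t) ≤ (b : ℝ) := by simpa [auxHS] using hp
    have : (∑ t, (a t : ℝ) * (x + r • (p - x)) t) ≤ (b : ℝ) := by
      rw [e]; nlinarith
    simpa only [auxHS, Set.mem_ofPred_eq, Bool.false_eq_true, if_false] using this
  · have hp : (∑ t, (a t : ℝ) * p t) < (b : ℝ) := by simpa [auxHS] using hp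
    have : (∑ t, (a t : ℝ) * (x + r • (p - x)) t) < (b : ℝ) := by
      rw [e]; nlinarith
    simpa only [auxHS, Set.mem_ofPred_eq, if_true] using this

theorem aux_sep {n N M : ℕ} (a : Fin N → Fin n → ℚ) (b : Fin N → ℚ) (s : Fin N → Bool)
    (a' : Fin M → Fin n → ℚ) (b' : Fin M → ℚ) (s' : Fin M → Bool) (c : ℝ) (hc : 0 < c)
    (hsep : ∀ x ∈ ⋂ j, auxHS (a j) (b j) (s j), ∀ y ∈ ⋂ j, auxHS (a' j) (b' j) (s' j), c ≤ dist x y) :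
    ∃ (u : Fin n → ℚ) (v : ℚ), (∀ x ∈ ⋂ j, auxHS (a j) (b j) (s j), ∑ t, (u t : ℝ) * x t + v ≤ 0) ∧
      (∀ x ∈ ⋂ j, auxHS (a' j) (b' j) (s' j), 1 ≤ ∑ t, (u t : ℝ) * x t + v) := by
  classical
  set P := ⋂ j, auxHS (a j) (b j) (s j) with hP
  set Q := ⋂ j, auxHS (a' j) (b' j) (s' j) with hQ
  rcases P.eq_empty_or_nonempty with hPe | ⟨p, hp⟩
  · exact ⟨0, 1, by simp [hPe], by simp⟩
  rcases Q.eq_empty_or_nonempty with hQe | ⟨q, hq⟩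
  · exact ⟨0, 0, by simp, by simp [hQe]⟩
  let C : Set ((Fin n → ℚ) × ℚ) := {t | ∃ (u : Fin n → ℚ) (v : ℚ),
    (∀ x ∈ P, ∑ i, (u i : ℝ) * x i ≤ v) ∧
    (∀ x ∈ Q, ∑ i, ((t.1 i : ℝ) - u i) * x i ≤ t.2 - v)}
  let T : Finset ((Fin n → ℚ) × ℚ) := Finset.univ.image (fun j => (a j, b j)) ∪
    Finset.univ.image (fun j => (a' j, b' j))
  obtain ⟨β, hβ, u, v, hu, hv⟩ := aux_fm n T C (by
      rintro t ⟨u, v, h1, h2⟩ t' ⟨u', v', h1', h2'⟩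
      refine ⟨u + u', v + v', fun x hx => ?_, fun x hx => ?_⟩
      · have := add_le_add (h1 x hx) (h1' x hx)
        rw [← Finset.sum_add_distrib] at this
        push_cast
        refine le_trans (le_of_eq ?_) this
        refine Finset.sum_congr rfl fun i _ => ?_
        simp; ring
      · have := add_le_add (h2 x hx) (h2' x hx)
        rw [← Finset.sum_add_distrib] at this
        simp only [Prod.fst_add, Prod.snd_add, Pi.add_apply]
        push_cast
        refine le_trans (le_of_eq ?_) (this.trans (le_of_eq (by ring)))
        refine Finset.sum_congr rfl fun i _ => ?_
        ring) (by
      rintro r hr t ⟨u, v, h1, h2⟩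
      have hr' : (0:ℝ) ≤ r := by exact_mod_cast hr.le
      refine ⟨r • u, r * v, fun x hx => ?_, fun x hx => ?_⟩
      · have := mul_le_mul_of_nonneg_left (h1 x hx) hr'
        rw [Finset.mul_sum] at this
        push_cast
        refine le_trans (le_of_eq ?_) this
        refine Finset.sum_congr rfl fun i _ => ?_
        simp; ring
      · have := mul_le_mul_of_nonneg_left (h2 x hx) hr'
        rw [Finset.mul_sum] at this
        simp only [Prod.smul_fst, Prod.smul_snd, Pi.smul_apply, smul_eq_mul]
        push_cast
        refine le_trans (le_of_eq ?_) (this.trans (le_of_eq (by ring)))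
        refine Finset.sum_congr rfl fun i _ => ?_
        ring) (by
      intro t ht
      rcases Finset.mem_union.1 ht with h | h
      · obtain ⟨j, -, rfl⟩ := Finset.mem_image.1 h
        exact ⟨a j, b j, fun x hx => auxHS_le (Set.mem_iInter.1 hx j), by simp⟩
      · obtain ⟨j, -, rfl⟩ := Finset.mem_image.1 h
        refine ⟨0, 0, by simp, fun x hx => ?_⟩
        simpa using auxHS_le (Set.mem_iInter.1 hx j)) (by
      rintro ⟨x, hx⟩
      let X : Fin n → ℝ := fun i => (x i : ℝ)
      have hX : ∀ t ∈ T, ∑ i, (t.1 i : ℝ) * X i ≤ (t.2 : ℝ) := by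
        intro t ht
        have := hx t ht
        simp only [X]
        exact_mod_cast this
      have hd : c ≤ dist p q := hsep p hp q hq
      have hd0 : 0 < dist p q := lt_of_lt_of_le hc hd
      let r := c / (2 * dist p q)
      have hr0 : 0 < r := by positivity
      have hr1 : r ≤ 1 := by
        simp only [r]; rw [div_le_one (by positivity)]; linarith
      have hp' : X + r • (p - X) ∈ P := Set.mem_iInter.2 fun j =>
        auxHS_conv (Set.mem_iInter.1 hp j) (hX (a j, b j) (Finset.mem_union_left _
          (Finset.mem_image_of_mem _ (Finset.mem_univ j)))) r hr0 hr1
      have hq' : X + r • (q - X) ∈ Q := Set.mem_iInter.2 fun j =>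
        auxHS_conv (Set.mem_iInter.1 hq j) (hX (a' j, b' j) (Finset.mem_union_right _
          (Finset.mem_image_of_mem (fun j => (a' j, b' j)) (Finset.mem_univ j)))) r hr0 hr1
      have h := hsep _ hp' _ hq'
      rw [dist_add_left, dist_smul₀, dist_sub_right, Real.norm_of_nonneg hr0.le] at h
      have : r * dist p q = c / 2 := by
        simp only [r]; field_simp
      linarith)
  have hβ' : (β : ℝ) < 0 := by exact_mod_cast hβ
  have hs : ∀ x : Fin n → ℝ, ∑ t, (((-β⁻¹) • u) t * x t : ℝ) + ((β⁻¹ * v : ℚ) : ℝ)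
      = (-(β:ℝ)⁻¹) * (∑ t, (u t : ℝ) * x t - v) := by
    intro x
    rw [mul_sub, Finset.mul_sum]
    push_cast
    have : ∀ t, ((((-β⁻¹) • u) t : ℚ) * x t : ℝ) = (-(β:ℝ)⁻¹) * ((u t : ℝ) * x t) := by
      intro t; simp; ring
    rw [Finset.sum_congr rfl fun t _ => this t]
    ring
  have hpos : 0 < -(β:ℝ)⁻¹ := by
    have := inv_lt_zero.2 hβ'
    linarith
  refine ⟨(-β⁻¹) • u, β⁻¹ * v, fun x hx => ?_, fun x hx => ?_⟩
  · rw [hs]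
    have := hu x hx
    nlinarith
  · rw [hs]
    have := hv x hx
    simp only [Pi.zero_apply, Rat.cast_zero, zero_sub, neg_mul, Finset.sum_neg_distrib] at this
    have h2 : -(β:ℝ) ≤ ∑ t, (u t : ℝ) * x t - v := by linarith
    have h3 := mul_le_mul_of_nonneg_left h2 hpos.le
    have : (-(β:ℝ)⁻¹) * -(β:ℝ) = 1 := by
      rw [neg_mul_neg, inv_mul_cancel₀ hβ'.ne]
    linarith

noncomputable def auxA {n p : ℕ} (G : (Fin n → ℝ) → (Fin p → ℝ)) : Submodule ℚ ((Fin n → ℝ) → ℝ) :=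
  Submodule.span ℚ ({fun _ => 1} ∪ Set.range (fun j x => G x j))

theorem auxA_one {n p : ℕ} (G : (Fin n → ℝ) → (Fin p → ℝ)) : (fun _ => 1) ∈ auxA G :=
  Submodule.subset_span (Or.inl rfl)

theorem auxA_coord {n p : ℕ} (G : (Fin n → ℝ) → (Fin p → ℝ)) (j : Fin p) :
    (fun x => G x j) ∈ auxA G :=
  Submodule.subset_span (Or.inr ⟨j, rfl⟩)

theorem auxA_le {n p : ℕ} {G : (Fin n → ℝ) → (Fin p → ℝ)} {M : Submodule ℚ ((Fin n → ℝ) → ℝ)}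
    (h1 : (fun _ => 1) ∈ M) (h : ∀ j, (fun x => G x j) ∈ M) : auxA G ≤ M := by
  refine Submodule.span_le.2 ?_
  rintro f (rfl | ⟨j, rfl⟩)
  · exact h1
  · exact h j

theorem auxA_repr {n p : ℕ} {G : (Fin n → ℝ) → (Fin p → ℝ)} {f : (Fin n → ℝ) → ℝ}
    (hf : f ∈ auxA G) : ∃ (w : Fin p → ℚ) (b : ℚ), ∀ x, f x = (∑ j, (w j : ℝ) * G x j) + b := by
  classical
  induction hf using Submodule.span_induction with
  | mem f h =>
    rcases h with rfl | ⟨j, rfl⟩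
    · exact ⟨0, 1, by simp⟩
    · refine ⟨Pi.single j 1, 0, fun x => ?_⟩
      rw [Finset.sum_eq_single j]
      · simp
      · intro i _ hi; simp [hi]
      · simp
  | zero => exact ⟨0, 0, by simp⟩
  | add f g _ _ hf hg =>
    obtain ⟨w, b, h⟩ := hf
    obtain ⟨w', b', h'⟩ := hg
    refine ⟨w + w', b + b', fun x => ?_⟩
    simp only [Pi.add_apply, h, h']
    push_cast
    simp only [add_mul, Finset.sum_add_distrib]
    ring
  | smul r f _ hf =>
    obtain ⟨w, b, h⟩ := hf
    refine ⟨r • w, r * b, fun x => ?_⟩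
    simp only [Pi.smul_apply, h, smul_eq_mul, Rat.smul_def]
    push_cast
    rw [mul_add, Finset.mul_sum]
    simp only [mul_assoc]

theorem aux_affcomp {n p : ℕ} (W : Matrix (Fin p) (Fin n) ℚ) (b : Fin p → ℚ) {l : ℕ}
    (W' : Matrix (Fin l) (Fin p) ℚ) (b' : Fin l → ℚ) (x : Fin n → ℝ) (i : Fin l) :
    (∑ j, (W' i j : ℝ) * ((∑ t, (W j t : ℝ) * x t) + b j)) + b' i =
    (∑ t, ((W' * W) i t : ℚ) * x t) + ((∑ j, W' i j * b j + b' i : ℚ) : ℝ) := by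
  push_cast [Matrix.mul_apply]
  simp only [mul_add, Finset.sum_add_distrib, Finset.mul_sum, Finset.sum_mul]
  rw [Finset.sum_comm]
  simp only [mul_assoc, add_assoc]

theorem aux_comp {n p m : ℕ} {G : (Fin n → ℝ) → (Fin p → ℝ)} (hG : ComputedByReLU n p G)
    {H : (Fin p → ℝ) → (Fin m → ℝ)} (hH : ComputedByReLU p m H) :
    ComputedByReLU n m (fun x => H (G x)) := by
  induction hG with
  | affine W b =>
    cases hH with
    | affine W' b' =>
      have := ComputedByReLU.affine (W' * W) (fun i => ∑ j, W' i j * b j + b' i)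
      convert this using 3
      exact aux_affcomp W b W' b' _ _
    | comp W' b' hF =>
      have := ComputedByReLU.comp (W' * W) (fun i => ∑ j, W' i j * b j + b' i) hF
      convert this using 5
      exact aux_affcomp W b W' b' _ _
  | comp W b hF ih => exact ComputedByReLU.comp W b (ih hH)

theorem aux_layer {n p : ℕ} {G : (Fin n → ℝ) → (Fin p → ℝ)} (hG : ComputedByReLU n p G)
    {ι : Type} [Fintype ι] (f : ι → (Fin n → ℝ) → ℝ) (hf : ∀ i, f i ∈ auxA G) :
    ∃ (p' : ℕ) (G' : (Fin n → ℝ) → (Fin p' → ℝ)), ComputedByReLU n p' G' ∧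
      ∀ i, (fun x => max (f i x) 0) ∈ auxA G' := by
  classical
  choose w b h using fun i => auxA_repr (hf i)
  let e := Fintype.equivFin ι
  have hI : ComputedByReLU (Fintype.card ι) (Fintype.card ι) (fun x => x) := by
    have := ComputedByReLU.affine (1 : Matrix (Fin (Fintype.card ι)) (Fin (Fintype.card ι)) ℚ) 0
    convert this using 3
    simp [Matrix.one_apply, apply_ite (Rat.cast : ℚ → ℝ)]
  have := aux_comp hG (ComputedByReLU.comp (fun i => w (e.symm i)) (fun i => b (e.symm i)) hI)
  refine ⟨_, _, this, fun i => ?_⟩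
  have h2 := auxA_coord (fun x : Fin n → ℝ => (fun i : Fin (Fintype.card ι) =>
    max ((∑ j, (w (e.symm i) j : ℝ) * G x j) + (b (e.symm i) : ℝ)) 0)) (e i)
  convert h2 using 3
  simp [h]

theorem aux_relu {n p : ℕ} {G : (Fin n → ℝ) → (Fin p → ℝ)} (hG : ComputedByReLU n p G)
    (f : (Fin n → ℝ) → ℝ) (hf : f ∈ auxA G) :
    ∃ (p' : ℕ) (G' : (Fin n → ℝ) → (Fin p' → ℝ)), ComputedByReLU n p' G' ∧
      auxA G ≤ auxA G' ∧ (fun x => max (f x) 0) ∈ auxA G' := by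
  obtain ⟨p', G', hG', h⟩ := aux_layer hG (ι := Option (Fin p ⊕ Fin p))
    (fun o => match o with
      | none => f
      | some (Sum.inl j) => fun x => G x j
      | some (Sum.inr j) => -(fun x => G x j)) (by
      rintro (_ | j | j)
      · exact hf
      · exact auxA_coord G j
      · exact Submodule.neg_mem _ (auxA_coord G j))
  refine ⟨p', G', hG', auxA_le (auxA_one _) (fun j => ?_), h none⟩
  have := Submodule.sub_mem _ (h (some (Sum.inl j))) (h (some (Sum.inr j)))
  convert this using 1
  ext x
  simp only [Pi.sub_apply, Pi.neg_apply]
  rcases le_total (G x j) 0 with h | h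
  · rw [max_eq_right h, max_eq_left (by linarith)]; ring
  · rw [max_eq_left h, max_eq_right (by linarith)]; ring

def auxGood {n : ℕ} (f : (Fin n → ℝ) → ℝ) : Prop :=
  ∀ (p : ℕ) (G : (Fin n → ℝ) → (Fin p → ℝ)), ComputedByReLU n p G →
    (∀ j, (fun x : Fin n → ℝ => x j) ∈ auxA G) →
    ∃ (p' : ℕ) (G' : (Fin n → ℝ) → (Fin p' → ℝ)), ComputedByReLU n p' G' ∧
      auxA G ≤ auxA G' ∧ f ∈ auxA G'

theorem auxGood_aff {n : ℕ} (u : Fin n → ℚ) (v : ℚ) :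
    auxGood (fun x : Fin n → ℝ => ∑ t, (u t : ℝ) * x t + v) := by
  intro p G hG hx
  refine ⟨p, G, hG, le_rfl, ?_⟩
  have := Submodule.add_mem _ (Submodule.sum_mem _ (t := Finset.univ)
    fun t _ => Submodule.smul_mem _ (u t) (hx t))
    (Submodule.smul_mem _ v (auxA_one G))
  convert this using 1
  ext x
  simp [Rat.smul_def]

theorem auxGood_add {n : ℕ} {f g : (Fin n → ℝ) → ℝ} (hf : auxGood f) (hg : auxGood g) :
    auxGood (f + g) := by
  intro p G hG hx
  obtain ⟨p1, G1, h1, l1, m1⟩ := hf p G hG hx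
  obtain ⟨p2, G2, h2, l2, m2⟩ := hg p1 G1 h1 (fun j => l1 (hx j))
  exact ⟨p2, G2, h2, l1.trans l2, Submodule.add_mem _ (l2 m1) m2⟩

theorem auxGood_smul {n : ℕ} {f : (Fin n → ℝ) → ℝ} (r : ℚ) (hf : auxGood f) :
    auxGood (r • f) := by
  intro p G hG hx
  obtain ⟨p1, G1, h1, l1, m1⟩ := hf p G hG hx
  exact ⟨p1, G1, h1, l1, Submodule.smul_mem _ r m1⟩

theorem auxGood_relu {n : ℕ} {f : (Fin n → ℝ) → ℝ} (hf : auxGood f) :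
    auxGood (fun x => max (f x) 0) := by
  intro p G hG hx
  obtain ⟨p1, G1, h1, l1, m1⟩ := hf p G hG hx
  obtain ⟨p2, G2, h2, l2, m2⟩ := aux_relu h1 f m1
  exact ⟨p2, G2, h2, l1.trans l2, m2⟩

theorem auxGood_const {n : ℕ} (v : ℚ) : auxGood (fun _ : Fin n → ℝ => (v : ℝ)) := by
  simpa using auxGood_aff (0 : Fin n → ℚ) v

theorem auxGood_compl {n : ℕ} {f : (Fin n → ℝ) → ℝ} (hf : auxGood f) :
    auxGood (fun x => 1 - f x) := by
  have := auxGood_add (auxGood_const 1) (auxGood_smul (-1) hf)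
  convert this using 1
  ext x
  simp; ring

/-- `auxSep P Q`: some network function vanishes on `P` and is one on `Q`. -/
def auxSep {n : ℕ} (P Q : Set (Fin n → ℝ)) : Prop :=
  ∃ f, auxGood f ∧ (∀ x ∈ P, f x = 0) ∧ (∀ x ∈ Q, f x = 1)

theorem auxSep_of {n : ℕ} {P Q : Set (Fin n → ℝ)} (f : (Fin n → ℝ) → ℝ) (hf : auxGood f)
    (hP : ∀ x ∈ P, f x ≤ 0) (hQ : ∀ x ∈ Q, 1 ≤ f x) : auxSep P Q := by
  refine ⟨_, auxGood_compl (auxGood_relu (auxGood_compl (auxGood_relu hf))), fun x hx => ?_,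
    fun x hx => ?_⟩
  · simp [max_eq_right (hP x hx)]
  · have := hQ x hx
    rw [max_eq_left (a := f x) (by linarith), max_eq_right (by linarith)]; ring

theorem auxSep_symm {n : ℕ} {P Q : Set (Fin n → ℝ)} (h : auxSep P Q) : auxSep Q P := by
  obtain ⟨f, hf, h0, h1⟩ := h
  exact ⟨_, auxGood_compl hf, fun x hx => by simp [h1 x hx], fun x hx => by simp [h0 x hx]⟩

theorem auxSep_union {n : ℕ} {P P' Q : Set (Fin n → ℝ)} (h : auxSep P Q) (h' : auxSep P' Q) :
    auxSep (P ∪ P') Q := by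
  obtain ⟨f, hf, h0, h1⟩ := auxSep_symm h
  obtain ⟨g, hg, h0', h1'⟩ := auxSep_symm h'
  refine auxSep_symm (auxSep_of _ (auxGood_add (auxGood_relu hf) (auxGood_relu hg)) ?_ ?_)
  · intro x hx; simp [h0 x hx, h0' x hx]
  · rintro x (hx | hx)
    · simp [h1 x hx]
    · simp [h1' x hx]

theorem auxSep_iUnion {n k : ℕ} {P : Fin k → Set (Fin n → ℝ)} {Q : Set (Fin n → ℝ)}
    (h : ∀ i, auxSep (P i) Q) : auxSep (⋃ i, P i) Q := by
  classical
  have : ∀ s : Finset (Fin k), auxSep (⋃ i ∈ s, P i) Q := by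
    intro s
    induction s using Finset.induction_on with
    | empty =>
      exact ⟨_, auxGood_const 1, by simp, by simp⟩
    | insert a s _ ih =>
      rw [Finset.set_biUnion_insert]
      exact auxSep_union (h a) ih
  simpa using this Finset.univ

theorem auxSep_semilinear {n : ℕ} {P Q : Set (Fin n → ℝ)} (hP : IsSemiLinear P)
    (hQ : IsSemiLinear Q) (c : ℝ) (hc : 0 < c) (h : ∀ x ∈ P, ∀ y ∈ Q, c ≤ dist x y) :
    auxSep P Q := by
  obtain ⟨K, N, a, b, s, rfl⟩ := hP
  obtain ⟨K', N', a', b', s', rfl⟩ := hQ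
  refine auxSep_iUnion fun i => auxSep_symm (auxSep_iUnion fun i' => auxSep_symm ?_)
  obtain ⟨u, v, h0, h1⟩ := aux_sep (a i) (b i) (s i) (a' i') (b' i') (s' i') c hc
    (fun x hx y hy => h x (Set.mem_iUnion.2 ⟨i, hx⟩) y (Set.mem_iUnion.2 ⟨i', hy⟩))
  exact auxSep_of _ (auxGood_aff u v) h0 h1

theorem auxGood_sum {n k : ℕ} (s : Finset (Fin k)) {f : Fin k → (Fin n → ℝ) → ℝ}
    (h : ∀ i, auxGood (f i)) : auxGood (∑ i ∈ s, f i) := by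
  classical
  induction s using Finset.induction_on with
  | empty =>
    have h := auxGood_const (n := n) 0
    rw [Rat.cast_zero] at h
    exact h
  | insert a s ha ih => rw [Finset.sum_insert ha]; exact auxGood_add (h a) ih

theorem auxGood_family {n m : ℕ} {f : Fin m → (Fin n → ℝ) → ℝ} (h : ∀ i, auxGood (f i)) :
    ComputedByReLU n m (fun x i => f i x) := by
  classical
  have key : ∀ s : Finset (Fin m), ∃ (p : ℕ) (G : (Fin n → ℝ) → (Fin p → ℝ)),
      ComputedByReLU n p G ∧ (∀ j, (fun x : Fin n → ℝ => x j) ∈ auxA G) ∧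
      ∀ i ∈ s, f i ∈ auxA G := by
    intro s
    induction s using Finset.induction_on with
    | empty =>
      have hI : ComputedByReLU n n (fun x => x) := by
        have := ComputedByReLU.affine (1 : Matrix (Fin n) (Fin n) ℚ) 0
        convert this using 3
        simp [Matrix.one_apply, apply_ite (Rat.cast : ℚ → ℝ)]
      exact ⟨n, _, hI, auxA_coord _, by simp⟩
    | insert a s _ ih =>
      obtain ⟨p, G, hG, hx, hs⟩ := ih
      obtain ⟨p1, G1, h1, l1, m1⟩ := h a p G hG hx
      refine ⟨p1, G1, h1, fun j => l1 (hx j), fun i hi => ?_⟩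
      rcases Finset.mem_insert.1 hi with rfl | hi
      · exact m1
      · exact l1 (hs i hi)
  obtain ⟨p, G, hG, -, hs⟩ := key Finset.univ
  choose w b hw using fun i => auxA_repr (hs i (Finset.mem_univ i))
  have := aux_comp hG (ComputedByReLU.affine w b)
  convert this using 3
  exact hw _ _

/-- A set of rules whose conditional parts are nonempty semi-linear sets that
are positively separated, with arbitrarily chosen rational target values, is
obeyed by some ReLU network. -/
theorem relu_network_for_separated_semilinear_rules (n m k : ℕ)
    (S : Fin k → Set (Fin n → ℝ)) (hSne : ∀ i, (S i).Nonempty)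
    (hSsl : ∀ i, IsSemiLinear (S i))
    (c : ℝ) (hc : 0 < c)
    (hsep : ∀ i j : Fin k, i ≠ j → ∀ x ∈ S i, ∀ y ∈ S j, c ≤ dist x y)
    (y : Fin k → Fin m → ℚ) :
    ∃ F : (Fin n → ℝ) → (Fin m → ℝ), ComputedByReLU n m F ∧
      ∀ i : Fin k, ∀ x ∈ S i, F x = fun j => (y i j : ℝ) := by
  classical
  have hsep' : ∀ i, auxSep (⋃ j, if j = i then ∅ else S j) (S i) := by
    intro i
    refine auxSep_iUnion fun j => ?_
    by_cases hj : j = i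
    · rw [if_pos hj]
      exact ⟨_, auxGood_const 1, by simp, by simp⟩
    · rw [if_neg hj]
      exact auxSep_semilinear (hSsl j) (hSsl i) c hc (hsep j i hj)
  choose h hg h0 h1 using hsep'
  refine ⟨_, auxGood_family (f := fun j => ∑ i, (y i j) • h i)
    (fun j => auxGood_sum _ fun i => auxGood_smul _ (hg i)), fun i x hx => ?_⟩
  ext j
  simp only [Finset.sum_apply, Pi.smul_apply, Rat.smul_def]
  rw [Finset.sum_eq_single i]
  · simp [h1 i x hx]
  · intro l _ hl
    rw [h0 l x (Set.mem_iUnion.2 ⟨i, by rw [if_neg (Ne.symm hl)]; exact hx⟩)]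
    simp
  · simp
end

section
/- Let φ_1, …, φ_k ⊆ (Fin n → ℝ) and ψ_1, …, ψ_k ⊆ (Fin m → ℝ) be semi-linear sets. Suppose N : (Fin n → ℝ) → (Fin m → ℝ) is computed by a ReLU network, N is not a constant function, and N obeys every rule, i.e. for every i and every x ∈ φ_i one has N x ∈ ψ_i. Then there exists a function F : (Fin n → ℝ) → (Fin m → ℝ) computed by a ReLU network such that F obeys every rule (∀ i, ∀ x ∈ φ_i, F x ∈ ψ_i) and F x₀ ≠ N x₀ for some input x₀. Consequently, a finite consistent and exhaustive set of such rules can only be obeyed by a constant function. -/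
open Filter Topology in
lemma relu_continuous {n m : ℕ} {F : (Fin n → ℝ) → (Fin m → ℝ)}
    (h : ComputedByReLU n m F) : Continuous F := by
  induction h with
  | affine W b => fun_prop
  | comp W b hF ih => exact ih.comp (by fun_prop)

lemma affine_aux {n k : ℕ} (W : Fin k → Fin n → ℚ) (b : Fin k → ℚ) (V : Fin k → ℚ) (c : ℚ)
    (x : Fin n → ℝ) :
    (∑ i, (V i : ℝ) * ((∑ j, (W i j : ℝ) * x j) + (b i : ℝ))) + (c : ℝ)
      = (∑ j, ((∑ i, V i * W i j : ℚ) : ℝ) * x j) + ((∑ i, V i * b i + c : ℚ) : ℝ) := by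
  push_cast
  simp only [mul_add, Finset.sum_add_distrib, Finset.sum_mul, Finset.mul_sum]
  rw [Finset.sum_comm]
  simp only [mul_assoc, add_assoc]

lemma relu_comp_affine {n k m : ℕ} (W : Matrix (Fin k) (Fin n) ℚ) (b : Fin k → ℚ)
    {F : (Fin k → ℝ) → (Fin m → ℝ)} (hF : ComputedByReLU k m F) :
    ComputedByReLU n m (fun x => F (fun i => (∑ j, (W i j : ℝ) * x j) + (b i : ℝ))) := by
  cases hF with
  | affine V c =>
    have := ComputedByReLU.affine (n := n) (m := m) (fun l j => ∑ i, V l i * W i j)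
      (fun l => ∑ i, V l i * b i + c l)
    convert this using 3
    exact affine_aux W b _ _ _
  | comp V c hF =>
    have := ComputedByReLU.comp (n := n) (m := m) (fun l j => ∑ i, V l i * W i j)
      (fun l => ∑ i, V l i * b i + c l) hF
    convert this using 5
    exact affine_aux W b _ _ _

lemma relu_comp {n k m : ℕ} {G : (Fin n → ℝ) → (Fin k → ℝ)} (hG : ComputedByReLU n k G)
    {F : (Fin k → ℝ) → (Fin m → ℝ)} (hF : ComputedByReLU k m F) :
    ComputedByReLU n m (fun x => F (G x)) := by
  induction hG with
  | affine W b => exact relu_comp_affine W b hF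
  | comp W b hG ih => exact ComputedByReLU.comp W b (ih hF)

lemma relu_bump {n : ℕ} (u w : Fin n → ℚ) (r : ℚ) :
    ComputedByReLU n n (fun x i => x i + max ((r : ℝ) - ∑ j, |x j - u j|) 0 * w i) := by
  have := ComputedByReLU.comp (n := n) (m := n)
    (Fin.append (fun i j => if i = j then 1 else 0) (fun i j => if i = j then -1 else 0)
      : Fin (n + n) → Fin n → ℚ)
    (Fin.append (fun i => - u i) u)
    (ComputedByReLU.comp
      (Fin.append (fun i j => if i = j then 1 else 0) (fun _ _ => -1) :
        Fin ((n + n) + 1) → Fin (n + n) → ℚ)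
      (Fin.append 0 (fun _ => r))
      (ComputedByReLU.affine
        (fun i => Fin.append (Fin.append (fun j => if i = j then 1 else 0)
          (fun j => if i = j then -1 else 0)) (fun _ => w i)) u))
  convert this using 3 with x i
  have e : ∀ t : ℝ, max t 0 + max (-t) 0 = |t| := by
    intro t
    rcases le_total t 0 with h | h
    · rw [max_eq_right h, max_eq_left (by linarith), abs_of_nonpos h]; ring
    · rw [max_eq_left h, max_eq_right (by linarith), abs_of_nonneg h]; ring
  have e2 : ∀ t : ℝ, max t 0 - max (-t) 0 = t := by
    intro t
    rcases le_total t 0 with h | h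
    · rw [max_eq_right h, max_eq_left (by linarith)]; ring
    · rw [max_eq_left h, max_eq_right (by linarith)]; ring
  have h1 := e2 (x i - u i)
  have h2 : ∑ j, |x j - u j| = ∑ j, max (x j - u j) 0 + ∑ j, max (-(x j - u j)) 0 := by
    rw [← Finset.sum_add_distrib]; simp only [e]
  rw [h2]
  have d1 : ∀ a b : Fin n, Fin.castAdd n a ≠ Fin.natAdd n b := by
    intro a b h
    have := congrArg Fin.val h
    simp at this
    omega
  have c1 : ∀ (P : Prop) [Decidable P], ((if P then (1:ℚ) else 0 : ℚ) : ℝ) = if P then 1 else 0 := by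
    intro P _; split_ifs <;> simp
  have c2 : ∀ (P : Prop) [Decidable P], ((if P then (-1:ℚ) else 0 : ℚ) : ℝ) = if P then -1 else 0 := by
    intro P _; split_ifs <;> simp
  have d2 : ∀ a b : Fin n, Fin.natAdd n a ≠ Fin.castAdd n b := fun a b => (d1 b a).symm
  have i1 : ∀ a b : Fin n, (Fin.castAdd n a = Fin.castAdd n b) = (a = b) := by
    intro a b; simp
  have i2 : ∀ a b : Fin n, (Fin.natAdd n a = Fin.natAdd n b) = (a = b) := by
    intro a b; simp
  simp only [Fin.sum_univ_add, Fin.append_left, Fin.append_right, c1, c2, d1, d2, i1, i2,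
    ite_mul, one_mul, zero_mul, neg_mul, Finset.sum_ite_eq, Finset.mem_univ, if_true, if_false,
    Finset.sum_const_zero, add_zero, zero_add, Pi.zero_apply, Rat.cast_zero, Rat.cast_neg,
    Rat.cast_one, Finset.sum_neg_distrib, Finset.univ_unique, Finset.sum_singleton, max_assoc,
    max_self]
  have h4 : ∀ j, -x j + (u j : ℝ) = -(x j - u j) := fun j => by ring
  have h5 : ∀ j, x j + -(u j : ℝ) = x j - u j := fun j => by ring
  simp only [h4, h5]
  have h3 : (r:ℝ) - (∑ j, max (x j - u j) 0 + ∑ j, max (-(x j - u j)) 0)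
      = -∑ j, max (x j - u j) 0 + -∑ j, max (-(x j - u j)) 0 + r := by ring
  rw [h3]
  linarith

open Filter Topology in
lemma semilinear_generic {n : ℕ} {S : Set (Fin n → ℝ)} (hS : IsSemiLinear S) :
    ∃ H : Set ((Fin n → ℝ) × ℝ), H.Finite ∧ (∀ h ∈ H, h.1 ≠ 0) ∧
      ∀ p : Fin n → ℝ, (∀ h ∈ H, ∑ t, h.1 t * p t ≠ h.2) →
        ∀ᶠ x in 𝓝 p, (x ∈ S ↔ p ∈ S) := by
  obtain ⟨K, P, a, b, s, rfl⟩ := hS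
  refine ⟨(Set.range fun ij : (i : Fin K) × Fin (P i) =>
    ((fun t => (a ij.1 ij.2 t : ℝ), (b ij.1 ij.2 : ℝ)) : (Fin n → ℝ) × ℝ)) ∩ {h | h.1 ≠ 0},
    (Set.finite_range _).inter_of_left _, fun h hh => hh.2, ?_⟩
  intro p hp
  have key : ∀ i, ∀ j, ∀ᶠ x in 𝓝 p,
      ((if s i j then (∑ t, (a i j t : ℝ) * x t) < (b i j : ℝ)
        else (∑ t, (a i j t : ℝ) * x t) ≤ (b i j : ℝ)) ↔
       (if s i j then (∑ t, (a i j t : ℝ) * p t) < (b i j : ℝ)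
        else (∑ t, (a i j t : ℝ) * p t) ≤ (b i j : ℝ))) := by
    intro i j
    by_cases h0 : (fun t => (a i j t : ℝ)) = 0
    · have : ∀ t, (a i j t : ℝ) = 0 := fun t => congrFun h0 t
      simp [this]
    · have hne := hp (fun t => (a i j t : ℝ), (b i j : ℝ)) ⟨⟨⟨i, j⟩, rfl⟩, h0⟩
      have hc : Continuous fun x : Fin n → ℝ => ∑ t, (a i j t : ℝ) * x t := by fun_prop
      rcases lt_or_gt_of_ne hne with hl | hl
      · filter_upwards [hc.continuousAt.eventually_lt continuousAt_const hl] with x hx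
        simp only at hl hx
        simp [hl, hx, hl.le, hx.le]
      · filter_upwards [continuousAt_const.eventually_lt hc.continuousAt hl] with x hx
        simp only at hl hx
        simp [not_lt.2 hl.le, not_lt.2 hx.le, not_le.2 hl, not_le.2 hx]
  filter_upwards [eventually_all.2 fun i => eventually_all.2 (key i)] with x hx
  simp only [Set.mem_iUnion, Set.mem_iInter, Set.mem_ofPred_eq]
  exact exists_congr fun i => forall_congr' fun j => hx i j

lemma hyper_dense {n : ℕ} (a : Fin n → ℝ) (ha : a ≠ 0) (b : ℝ) :
    Dense {x : Fin n → ℝ | ∑ t, a t * x t ≠ b} := by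
  intro p
  by_cases hp : ∑ t, a t * p t = b
  · have hc : Continuous fun s : ℝ => p + s • a := by fun_prop
    have h1 : (0:ℝ) ∈ closure {0}ᶜ := (dense_compl_singleton (0:ℝ)) 0
    have h2 := map_mem_closure (t := {x : Fin n → ℝ | ∑ t, a t * x t ≠ b}) hc h1 ?_
    · simpa using h2
    · intro s hs
      have hs' : s ≠ 0 := hs
      have : ∑ t, a t * (p + s • a) t = b + s * ∑ t, a t * a t := by
        rw [← hp, Finset.mul_sum, ← Finset.sum_add_distrib]
        refine Finset.sum_congr rfl fun t _ => ?_
        simp; ring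
      have h3 : ∑ t, a t * a t ≠ 0 := by
        intro h
        apply ha
        exact dotProduct_self_eq_zero.1 h
      simp only [Set.mem_ofPred_eq, this]
      simp [hs', h3]
  · exact subset_closure hp

open Filter Topology in
lemma exists_nonlocconst {n m : ℕ} (N : (Fin n → ℝ) → (Fin m → ℝ)) (hN : Continuous N)
    (hnc : ¬ ∃ c : Fin m → ℝ, ∀ x, N x = c)
    (H : Set ((Fin n → ℝ) × ℝ)) (hf : H.Finite) (h0 : ∀ h ∈ H, h.1 ≠ 0) :
    ∃ p, (∀ h ∈ H, ∑ t, h.1 t * p t ≠ h.2) ∧ ¬ ∀ᶠ x in 𝓝 p, N x = N p := by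
  by_contra! hcon
  have hd : Dense (⋂ h ∈ H, {p : Fin n → ℝ | ∑ t, h.1 t * p t ≠ h.2}) := by
    apply dense_biInter_of_isOpen
    · intro h _
      exact isOpen_ne_fun (by fun_prop) continuous_const
    · exact hf.countable
    · intro h hh
      exact hyper_dense _ (h0 h hh) _
  have key : ∀ x ∈ (⋂ h ∈ H, {p : Fin n → ℝ | ∑ t, h.1 t * p t ≠ h.2}), ∀ y, N x = N y := by
    intro x hx y
    simp only [Set.mem_iInter, Set.mem_ofPred_eq] at hx
    set f : ℝ → (Fin m → ℝ) := fun t => N (x + t • (y - x)) with hfdef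
    set B : Set ℝ := ⋃ h ∈ H, {s : ℝ | ∑ t, h.1 t * (x + s • (y - x)) t = h.2} with hB
    have hBc : B.Countable := by
      refine hf.countable.biUnion fun h hh => Set.Subsingleton.countable ?_
      intro s hs s' hs'
      have e : ∀ s : ℝ, ∑ t, h.1 t * (x + s • (y - x)) t
          = ∑ t, h.1 t * x t + s * ∑ t, h.1 t * (y t - x t) := by
        intro s
        rw [Finset.mul_sum, ← Finset.sum_add_distrib]
        refine Finset.sum_congr rfl fun t _ => ?_
        simp; ring
      simp only [Set.mem_ofPred_eq, e] at hs hs'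
      have hm : (s - s') * ∑ t, h.1 t * (y t - x t) = 0 := by linarith
      rcases mul_eq_zero.1 hm with h1 | h1
      · linarith
      · rw [h1] at hs
        exact absurd (by linarith) (hx h hh)
    have hcl : Continuous fun t : ℝ => x + t • (y - x) := by fun_prop
    have := MeasureTheory.integral_eq_of_hasDerivAt_off_countable_of_le f (fun _ => 0)
      (zero_le_one' ℝ) hBc (hN.comp hcl).continuousOn ?_ (by simp)
    · simp [hfdef] at this
      exact (sub_eq_zero.1 this.symm).symm
    · intro t ht
      have hp := hcon (x + t • (y - x)) (by
        intro h hh he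
        exact ht.2 (Set.mem_biUnion hh he))
      have := (hcl.continuousAt (x := t)).eventually hp
      exact (hasDerivAt_const t (f t)).congr_of_eventuallyEq this
  obtain ⟨x, hx⟩ := hd.nonempty
  exact hnc ⟨N x, fun y => (key x hx y).symm⟩

/-- A non-constant ReLU-computable function obeying a finite set of semi-linear
rules can always be altered to another ReLU-computable function that still
obeys all the rules; hence a consistent and exhaustive set of such rules forces
a constant function. -/
theorem semilinear_rules_nonconstant_not_exhaustive (n m k : ℕ)
    (φ : Fin k → Set (Fin n → ℝ)) (ψ : Fin k → Set (Fin m → ℝ))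
    (hφ : ∀ i, IsSemiLinear (φ i)) (hψ : ∀ i, IsSemiLinear (ψ i))
    (N : (Fin n → ℝ) → (Fin m → ℝ)) (hN : ComputedByReLU n m N)
    (hnc : ¬ ∃ c : Fin m → ℝ, ∀ x, N x = c)
    (hobeys : ∀ i : Fin k, ∀ x ∈ φ i, N x ∈ ψ i) :
    ∃ F : (Fin n → ℝ) → (Fin m → ℝ), ComputedByReLU n m F ∧
      (∀ i : Fin k, ∀ x ∈ φ i, F x ∈ ψ i) ∧
      ∃ x₀ : Fin n → ℝ, F x₀ ≠ N x₀ := by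
  have hNc := relu_continuous hN
  choose H hHf hH0 hH using fun i => semilinear_generic (hφ i)
  obtain ⟨p, hp, hpn⟩ := exists_nonlocconst N hNc hnc (⋃ i, H i) (Set.finite_iUnion hHf)
    (by intro h hh; obtain ⟨i, hi⟩ := Set.mem_iUnion.1 hh; exact hH0 i h hi)
  have hev := Filter.eventually_all.2 fun i => hH i p
    (fun h hh => hp h (Set.mem_iUnion.2 ⟨i, hh⟩))
  obtain ⟨ε, hε, hball⟩ := Metric.eventually_nhds_iff.1 hev
  set δ : ℝ := ε / (4 * (n + 1)) with hδdef
  have hn1 : (0:ℝ) < n + 1 := by positivity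
  have hδ : 0 < δ := by positivity
  have hδn : δ * (n + 1) = ε / 4 := by rw [hδdef]; field_simp
  have hδε : δ ≤ ε / 4 := by nlinarith [(Nat.cast_nonneg n : (0:ℝ) ≤ n)]
  have hdr : Dense (Set.range fun (u : Fin n → ℚ) => fun i => (u i : ℝ)) :=
    DenseRange.piMap fun _ => Rat.denseRange_cast
  -- rational points with different values
  obtain ⟨u, v, hu, hv, huv⟩ : ∃ u v : Fin n → ℚ, dist (fun i => (u i : ℝ)) p < δ ∧
      dist (fun i => (v i : ℝ)) p < δ ∧ N (fun i => (u i : ℝ)) ≠ N (fun i => (v i : ℝ)) := by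
    by_contra! hcon
    apply hpn
    obtain ⟨_, hu, ⟨u, rfl⟩⟩ := hdr.inter_open_nonempty (Metric.ball p δ) Metric.isOpen_ball
      ⟨p, Metric.mem_ball_self hδ⟩
    have hall : ∀ x ∈ Metric.ball p δ, N x = N (fun i => (u i : ℝ)) := by
      intro x hx
      have hcl : x ∈ closure (Metric.ball p δ ∩
          Set.range fun (u : Fin n → ℚ) => fun i => (u i : ℝ)) :=
        hdr.open_subset_closure_inter Metric.isOpen_ball hx
      have hcs : IsClosed {x | N x = N (fun i => (u i : ℝ))} :=
        isClosed_eq hNc continuous_const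
      refine closure_minimal ?_ hcs hcl
      rintro _ ⟨h1, ⟨v, rfl⟩⟩
      exact hcon v u h1 hu
    filter_upwards [Metric.ball_mem_nhds p hδ] with x hx
    rw [hall x hx, hall p (Metric.mem_ball_self hδ)]
  obtain ⟨r, hr1, hr2⟩ := exists_rat_btwn (show ε / 2 < 3 * ε / 4 by linarith)
  have hr0 : (0:ℝ) < r := by linarith
  set w : Fin n → ℚ := fun i => (v i - u i) / r with hw
  have hwsum : ∑ i, |(w i : ℝ)| ≤ 1 := by
    have h1 : ∀ i, |(w i : ℝ)| ≤ 2 * δ / r := by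
      intro i
      simp only [hw]
      push_cast
      rw [abs_div, abs_of_pos hr0]
      gcongr
      have a1 := (dist_le_pi_dist (fun i => (u i : ℝ)) p i).trans_lt hu
      have a2 := (dist_le_pi_dist (fun i => (v i : ℝ)) p i).trans_lt hv
      rw [Real.dist_eq, abs_lt] at a1 a2
      rw [abs_le]
      constructor <;> linarith [a1.1, a1.2, a2.1, a2.2]
    calc ∑ i, |(w i : ℝ)| ≤ ∑ _i : Fin n, 2 * δ / r := Finset.sum_le_sum fun i _ => h1 i
      _ = n * (2 * δ) / r := by simp; ring
      _ ≤ 1 := by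
        rw [div_le_one hr0]
        nlinarith
  set g : (Fin n → ℝ) → (Fin n → ℝ) :=
    fun x i => x i + max ((r : ℝ) - ∑ j, |x j - u j|) 0 * w i with hg
  -- the small cross-polytope lies in the ball
  have hin : ∀ x : Fin n → ℝ, ∑ j, |x j - u j| ≤ r → dist x p < ε := by
    intro x hx
    have h1 : dist x (fun i => (u i : ℝ)) ≤ r := by
      rw [dist_pi_le_iff hr0.le]
      intro i
      rw [Real.dist_eq]
      exact (Finset.single_le_sum (f := fun j => |x j - u j|)
        (fun j _ => abs_nonneg _) (Finset.mem_univ i)).trans hx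
    have := dist_triangle x (fun i => (u i : ℝ)) p
    linarith
  refine ⟨fun x => N (g x), relu_comp (relu_bump u w r) hN, ?_, fun i => (u i : ℝ), ?_⟩
  · intro i x hx
    apply hobeys
    by_cases hxr : ∑ j, |x j - u j| ≤ r
    · have hgx : ∑ j, |g x j - u j| ≤ r := by
        have hm : max ((r : ℝ) - ∑ j, |x j - u j|) 0 = r - ∑ j, |x j - u j| :=
          max_eq_left (by linarith)
        calc ∑ j, |g x j - u j|
            ≤ ∑ j, (|x j - u j| + ((r : ℝ) - ∑ j, |x j - u j|) * |(w j : ℝ)|) := by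
              refine Finset.sum_le_sum fun j _ => ?_
              simp only [hg]
              rw [hm, add_sub_right_comm]
              refine (abs_add_le _ _).trans ?_
              rw [abs_mul, abs_of_nonneg (show (0:ℝ) ≤ r - ∑ j, |x j - u j| by linarith)]
          _ = ∑ j, |x j - u j| + ((r : ℝ) - ∑ j, |x j - u j|) * ∑ j, |(w j : ℝ)| := by
              rw [Finset.sum_add_distrib, Finset.mul_sum]
          _ ≤ r := by nlinarith
      exact (hball (hin _ hgx) i).2 ((hball (hin _ hxr) i).1 hx)
    · have : g x = x := by
        funext j
        simp only [hg]
        rw [max_eq_right (by linarith)]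
        ring
      rwa [this]
  · have : g (fun i => (u i : ℝ)) = fun i => (v i : ℝ) := by
      funext j
      simp only [hg, hw]
      push_cast
      simp [max_eq_left hr0.le]
      field_simp
      ring
    simp only [this]
    exact huv.symm
end

section
/- Let N : (Fin n → ℝ) → ℝ be continuous and piecewise linear in the sense that there exist finitely many affine functions g_1, …, g_p (each g_i x = (∑ j, a_i j * x j) + b_i with real coefficients) such that for every x there is some i with N x = g_i x. If N is not a constant function, then there exist a point z : Fin n → ℝ, a radius r > 0, and an affine function g whose linear part is nonzero, such that N x = g x for all x in the open ball of radius r centered at z. -/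
/-- Every non-constant continuous piecewise-linear function is affine with
nonzero linear part on some open ball. -/
theorem nonconstant_piecewise_linear_has_sloped_ball (n : ℕ)
    (N : (Fin n → ℝ) → ℝ) (hN : Continuous N)
    (p : ℕ) (a : Fin p → Fin n → ℝ) (b : Fin p → ℝ)
    (hpl : ∀ x : Fin n → ℝ, ∃ i : Fin p, N x = (∑ j, a i j * x j) + b i)
    (hnc : ¬ ∃ c : ℝ, ∀ x, N x = c) :
    ∃ (z : Fin n → ℝ) (r : ℝ), 0 < r ∧
      ∃ (g : Fin n → ℝ) (gb : ℝ), (∃ j, g j ≠ 0) ∧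
        ∀ x ∈ Metric.ball z r, N x = (∑ j, g j * x j) + gb := by
  by_contra hcon
  have hcl : ∀ i : Fin p, IsClosed {x : Fin n → ℝ | N x = (∑ j, a i j * x j) + b i} := fun i =>
    isClosed_eq hN (by fun_prop)
  have hd := dense_iUnion_interior_of_closed hcl (by
    ext x
    simpa using hpl x)
  have hfin : (Set.range b).Finite := Set.finite_range b
  have hsub : ∀ x, N x ∈ Set.range b := by
    have hc : IsClosed (N ⁻¹' Set.range b) := hfin.isClosed.preimage hN
    have h : (⋃ i, interior {x : Fin n → ℝ | N x = (∑ j, a i j * x j) + b i})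
        ⊆ N ⁻¹' Set.range b := by
      intro x hx
      obtain ⟨i, hi⟩ := Set.mem_iUnion.1 hx
      have hx' : N x = (∑ j, a i j * x j) + b i := by
        have := interior_subset hi
        exact this
      obtain ⟨r, hr, hb⟩ := Metric.isOpen_iff.1 isOpen_interior x hi
      have h0 : ∀ j, a i j = 0 := by
        by_contra! hne
        exact hcon ⟨x, r, hr, a i, b i, hne, fun y hy => by
          have := interior_subset (hb hy)
          exact this⟩
      exact ⟨i, by simp [hx', h0]⟩
    intro x
    exact hc.closure_subset_iff.2 h (hd x)
  have hpre : IsPreconnected (Set.range N) := isPreconnected_range hN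
  have hsb : (Set.range N).Subsingleton := by
    by_contra hns
    exact (hpre.infinite_of_nontrivial (Set.not_subsingleton_iff.1 hns))
      (hfin.subset (Set.range_subset_iff.2 hsub))
  exact hnc ⟨N 0, fun x => hsb ⟨x, rfl⟩ ⟨0, rfl⟩⟩
end

section
/- Let S be a 3-CNF formula over n variables with q ≥ 1 clauses, and let N_S : (Fin n → ℝ) → ℝ be the associated gadget function. Then (for all x : Fin n → ℝ with 0 ≤ x i ≤ 1 for all i, N_S x < 1) holds if and only if no assignment b : Fin n → Bool satisfies S. Moreover, for every x in the unit cube, 0 ≤ N_S x ≤ 1. -/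
/-- An assignment `b` satisfies the 3-CNF formula `S` if every clause contains
a literal made true by `b`. -/
def Satisfies {n q : ℕ} (S : Fin q → Fin 3 → Fin n × Bool) (b : Fin n → Bool) : Prop :=
  ∀ j : Fin q, ∃ t : Fin 3, b (S j t).1 = (S j t).2

/-- The clamp gadget `f t = ReLU (ReLU t − ReLU (t−1))`. -/
noncomputable def clampGadget (t : ℝ) : ℝ := max (max t 0 - max (t - 1) 0) 0

/-- The literal gadget: value of the `t`-th literal of clause `j` at input `x`. -/
noncomputable def litVal {n q : ℕ} (S : Fin q → Fin 3 → Fin n × Bool)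
    (j : Fin q) (t : Fin 3) (x : Fin n → ℝ) : ℝ :=
  if (S j t).2 = true then clampGadget (2 * x (S j t).1 - 1)
  else clampGadget (1 - 2 * x (S j t).1)

/-- The clause gadget: value of clause `j` at input `x`. -/
noncomputable def clauseVal {n q : ℕ} (S : Fin q → Fin 3 → Fin n × Bool)
    (j : Fin q) (x : Fin n → ℝ) : ℝ :=
  clampGadget (litVal S j 0 x + litVal S j 1 x + litVal S j 2 x)

/-- The gadget network `N_S` associated to the 3-CNF formula `S`. -/
noncomputable def gadgetNet {n q : ℕ} (S : Fin q → Fin 3 → Fin n × Bool)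
    (x : Fin n → ℝ) : ℝ :=
  max ((∑ j, clauseVal S j x) - ((q : ℝ) - 1)) 0

theorem clampGadget_nonneg' (t : ℝ) : 0 ≤ clampGadget t := le_max_right _ _

theorem clampGadget_le_one' (t : ℝ) : clampGadget t ≤ 1 := by
  unfold clampGadget
  rcases max_cases t 0 with h | h <;> rcases max_cases (t - 1) 0 with h' | h' <;>
    apply max_le <;> linarith

theorem clampGadget_of_one_le' {t : ℝ} (ht : 1 ≤ t) : clampGadget t = 1 := by
  unfold clampGadget
  rw [max_eq_left (by linarith : (0:ℝ) ≤ t), max_eq_left (by linarith : (0:ℝ) ≤ t - 1)]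
  norm_num

theorem clampGadget_of_nonpos' {t : ℝ} (ht : t ≤ 0) : clampGadget t = 0 := by
  unfold clampGadget
  rw [max_eq_right ht, max_eq_right (by linarith : t - 1 ≤ 0)]
  norm_num

theorem litVal_nonneg' {n q : ℕ} (S : Fin q → Fin 3 → Fin n × Bool)
    (j : Fin q) (t : Fin 3) (x : Fin n → ℝ) : 0 ≤ litVal S j t x := by
  unfold litVal
  split_ifs <;> exact clampGadget_nonneg' _

theorem gadgetNet_le_one' {n q : ℕ} (S : Fin q → Fin 3 → Fin n × Bool)
    (x : Fin n → ℝ) : gadgetNet S x ≤ 1 := by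
  have h : ∑ j, clauseVal S j x ≤ ∑ _j : Fin q, (1:ℝ) :=
    Finset.sum_le_sum fun j _ => clampGadget_le_one' _
  simp at h
  exact max_le (by linarith) (by norm_num)

theorem clauseVal_eq_one' {n q : ℕ} (S : Fin q → Fin 3 → Fin n × Bool)
    (x : Fin n → ℝ) (hx : 1 ≤ gadgetNet S x) (j : Fin q) : 1 ≤ clauseVal S j x := by
  by_contra hj
  push Not at hj
  have h : ∑ j, clauseVal S j x < ∑ _j : Fin q, (1:ℝ) :=
    Finset.sum_lt_sum (fun j _ => clampGadget_le_one' _) ⟨j, Finset.mem_univ _, hj⟩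
  simp at h
  have : gadgetNet S x < 1 := max_lt (by linarith) (by norm_num)
  linarith

theorem sat_of_one_le' {n q : ℕ} (S : Fin q → Fin 3 → Fin n × Bool)
    (x : Fin n → ℝ) (hx : 1 ≤ gadgetNet S x) :
    Satisfies S (fun i => decide (1 / 2 < x i)) := by
  intro j
  by_contra hc
  push Not at hc
  have hz : ∀ t, litVal S j t x = 0 := by
    intro t
    have := hc t
    unfold litVal
    split_ifs with h
    · rw [h] at this
      simp at this
      exact clampGadget_of_nonpos' (by linarith)
    · rw [Bool.not_eq_true] at h
      rw [h] at this
      simp at this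
      exact clampGadget_of_nonpos' (by linarith)
  have h1 := clauseVal_eq_one' S x hx j
  unfold clauseVal at h1
  rw [hz, hz, hz, clampGadget_of_nonpos' (by norm_num)] at h1
  norm_num at h1

theorem one_le_of_sat' {n q : ℕ} (S : Fin q → Fin 3 → Fin n × Bool)
    (b : Fin n → Bool) (hb : Satisfies S b) :
    1 ≤ gadgetNet S (fun i => if b i = true then 1 else 0) := by
  have hc : ∀ j, clauseVal S j (fun i => if b i = true then 1 else 0) = 1 := by
    intro j
    obtain ⟨t, ht⟩ := hb j
    have hl : litVal S j t (fun i => if b i = true then 1 else 0) = 1 := by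
      unfold litVal
      split_ifs with h
      · exact clampGadget_of_one_le' (by beta_reduce; rw [ht, h]; norm_num)
      · exact clampGadget_of_one_le' (by beta_reduce; rw [ht, if_neg h]; norm_num)
    apply clampGadget_of_one_le'
    have h0 := litVal_nonneg' S j 0 (fun i => if b i = true then 1 else 0)
    have h1 := litVal_nonneg' S j 1 (fun i => if b i = true then 1 else 0)
    have h2 := litVal_nonneg' S j 2 (fun i => if b i = true then 1 else 0)
    fin_cases t <;> simp only [Fin.zero_eta, Fin.mk_one, Fin.reduceFinMk] at hl <;> linarith
  unfold gadgetNet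
  apply le_max_of_le_left
  simp [hc]

/-- Correctness of the 3SAT reduction: the gadget network stays below `1` on
the unit cube iff the formula is unsatisfiable, and it always maps the unit
cube into `[0,1]`. -/
theorem gadgetNet_lt_one_iff_unsat (n q : ℕ) (hq : 1 ≤ q)
    (S : Fin q → Fin 3 → Fin n × Bool) :
    ((∀ x : Fin n → ℝ, (∀ i, 0 ≤ x i ∧ x i ≤ 1) → gadgetNet S x < 1) ↔
      ¬ ∃ b : Fin n → Bool, Satisfies S b) ∧
    (∀ x : Fin n → ℝ, (∀ i, 0 ≤ x i ∧ x i ≤ 1) →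
      0 ≤ gadgetNet S x ∧ gadgetNet S x ≤ 1) := by
  refine ⟨⟨?_, ?_⟩, fun x _ => ⟨le_max_right _ _, gadgetNet_le_one' S x⟩⟩
  · rintro h ⟨b, hb⟩
    refine absurd (h (fun i => if b i = true then 1 else 0) ?_) (not_lt.2 (one_le_of_sat' S b hb))
    intro i
    split_ifs <;> norm_num
  · intro h x _
    by_contra hx
    exact h ⟨_, sat_of_one_le' S x (not_lt.1 hx)⟩
end

section
/- Let n ≥ 1 and define g : (Fin n → ℝ) → ℝ by g x = min over i ∈ Fin n of min (max (x i) 0) (max (1 − x i) 0). Then: (i) g x ≥ 0 for every x; (ii) if x i < 0 or x i > 1 for some i, then g x = 0; (iii) if 0 ≤ x i ≤ 1 for all i, then 0 ≤ x 0 + g x ≤ 1; and (iv) the map x ↦ Function.update x 0 (x 0 + g x) (which adds g x to the first coordinate and leaves the others unchanged) is computed by a ReLU network. -/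
theorem cbr_comp_affine {k m : ℕ} {F : (Fin k → ℝ) → (Fin m → ℝ)} (hF : ComputedByReLU k m F)
    {n : ℕ} (A : Matrix (Fin k) (Fin n) ℚ) (c : Fin k → ℚ) :
    ComputedByReLU n m (fun x => F (fun i => (∑ j, (A i j : ℝ) * x j) + (c i : ℝ))) := by
  have key : ∀ {p k : ℕ} (W : Matrix (Fin p) (Fin k) ℚ) (b : Fin p → ℚ)
      (A : Matrix (Fin k) (Fin n) ℚ) (c : Fin k → ℚ) (x : Fin n → ℝ) (i : Fin p),
      (∑ j, (((W * A) i j : ℚ) : ℝ) * x j) + (((∑ j, W i j * c j) + b i : ℚ) : ℝ)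
      = (∑ j, (W i j : ℝ) * ((∑ l, (A j l : ℝ) * x l) + (c j : ℝ))) + (b i : ℝ) := by
    intro p k W b A c x i
    simp only [Matrix.mul_apply]
    push_cast
    simp only [mul_add, Finset.sum_add_distrib, Finset.mul_sum, Finset.sum_mul]
    rw [Finset.sum_comm]
    simp only [mul_assoc, add_assoc]
  cases hF with
  | affine W b =>
    have := ComputedByReLU.affine (W * A) (fun i => (∑ j, W i j * c j) + b i)
    simpa only [key] using this
  | comp W b hF =>
    have := ComputedByReLU.comp (W * A) (fun i => (∑ j, W i j * c j) + b i) hF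
    simpa only [key] using this

theorem cbr_block {k m : ℕ} {F : (Fin k → ℝ) → (Fin m → ℝ)} (hF : ComputedByReLU k m F)
    (c w : Fin k → ℚ) (b : ℚ) :
    ComputedByReLU k m
      (fun z => F (fun i => z i + (c i : ℝ) * max ((∑ j, (w j : ℝ) * z j) + (b : ℝ)) 0)) := by
  let e : Fin (Fintype.card (Fin k ⊕ Fin k ⊕ Unit)) ≃ (Fin k ⊕ Fin k ⊕ Unit) :=
    (Fintype.equivFin _).symm
  have h1 := cbr_comp_affine hF
    (fun i a => Sum.elim (fun j => if i = j then 1 else 0)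
      (Sum.elim (fun j => if i = j then -1 else 0) (fun _ => c i)) (e a)) (fun _ => 0)
  have h2 := ComputedByReLU.comp
    (fun a j => Sum.elim (fun i => if i = j then (1 : ℚ) else 0)
      (Sum.elim (fun i => if i = j then -1 else 0) (fun _ => w j)) (e a))
    (fun a => Sum.elim (fun _ => 0) (Sum.elim (fun _ => 0) (fun _ => b)) (e a)) h1
  convert h2 using 2 with z
  congr 1
  funext i
  rw [Equiv.sum_comp e (fun a : Fin k ⊕ Fin k ⊕ Unit =>
    ((Sum.elim (fun j => if i = j then (1 : ℚ) else 0)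
      (Sum.elim (fun j => if i = j then -1 else 0) (fun _ => c i)) a : ℚ) : ℝ) *
    max ((∑ j, ((Sum.elim (fun i => if i = j then (1 : ℚ) else 0)
      (Sum.elim (fun i => if i = j then -1 else 0) (fun _ => w j)) a : ℚ) : ℝ) * z j) +
      ((Sum.elim (fun _ => 0) (Sum.elim (fun _ => 0) (fun _ => b)) a : ℚ) : ℝ)) 0)]
  simp only [Fintype.sum_sum_type, Sum.elim_inl, Sum.elim_inr, apply_ite (Rat.cast : ℚ → ℝ),
    ite_mul, Finset.sum_ite_eq, Finset.mem_univ, if_true, Rat.cast_one, Rat.cast_zero,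
    Rat.cast_neg, zero_mul, one_mul, neg_mul, add_zero, Finset.univ_unique, Finset.sum_singleton]
  have : max (z i) 0 - max (-z i) 0 = z i := by
    rcases le_total (z i) 0 with h | h
    · rw [max_eq_right h, max_eq_left (by linarith)]; ring
    · rw [max_eq_left h, max_eq_right (by linarith)]; ring
  linarith

/-- running minimum -/
noncomputable def cbrFold {n : ℕ} (x : Fin n → ℝ) (y : ℝ) (l : List (Fin n)) : ℝ :=
  l.foldr (fun i y => min (min y (x i)) (1 - x i)) y

theorem le_cbrFold {n : ℕ} (x : Fin n → ℝ) (y t : ℝ) (l : List (Fin n)) :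
    t ≤ cbrFold x y l ↔ t ≤ y ∧ ∀ i ∈ l, t ≤ x i ∧ t ≤ 1 - x i := by
  induction l with
  | nil => simp [cbrFold]
  | cons a l ih =>
    have : cbrFold x y (a :: l) = min (min (cbrFold x y l) (x a)) (1 - x a) := rfl
    rw [this, le_min_iff, le_min_iff, ih, List.forall_mem_cons]
    tauto

theorem cbr_step {n m : ℕ} {F : (Fin (n+1) → ℝ) → (Fin m → ℝ)}
    (hF : ComputedByReLU (n+1) m F) (s : ℚ) (w : Fin n → ℚ) (v b : ℚ) :
    ComputedByReLU (n+1) m (fun z => F (Fin.cons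
      (z 0 + s * max (v * z 0 + (∑ j, (w j : ℝ) * z j.succ) + b) 0) (fun i => z i.succ))) := by
  have h := cbr_block hF (Fin.cons s (fun _ => 0)) (Fin.cons v w) b
  convert h using 2 with z
  congr 1
  funext i
  refine Fin.cases ?_ (fun i => ?_) i
  · simp [Fin.sum_univ_succ]
  · simp

theorem cbr_min {n m : ℕ} {F : (Fin (n+1) → ℝ) → (Fin m → ℝ)}
    (hF : ComputedByReLU (n+1) m F) (i : Fin n) :
    ComputedByReLU (n+1) m (fun z => F (Fin.cons
      (min (min (z 0) (z i.succ)) (1 - z i.succ)) (fun i => z i.succ))) := by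
  have h1 := cbr_step hF (-1) (fun j => if i = j then 1 else 0) 1 (-1)
  have h2 := cbr_step h1 (-1) (fun j => if i = j then -1 else 0) 1 0
  have key : ∀ a b : ℝ, min a b = a - max (a - b) 0 := by
    intro a b
    rcases le_total a b with h | h
    · rw [min_eq_left h, max_eq_right (by linarith)]; ring
    · rw [min_eq_right h, max_eq_left (by linarith)]; ring
  convert h2 using 2 with z
  congr 1
  simp only [Fin.cons_zero, Fin.cons_succ, apply_ite (Rat.cast : ℚ → ℝ),
    ite_mul, Finset.sum_ite_eq, Finset.mem_univ, if_true, Rat.cast_one, Rat.cast_zero,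
    Rat.cast_neg, zero_mul, one_mul, neg_mul, add_zero]
  congr 1
  rw [key (min _ _), key (z 0)]
  ring_nf

theorem cbr_fold {n m : ℕ} (l : List (Fin n)) {F : (Fin (n+1) → ℝ) → (Fin m → ℝ)}
    (hF : ComputedByReLU (n+1) m F) :
    ComputedByReLU (n+1) m (fun z => F (Fin.cons
      (cbrFold (fun i => z i.succ) (z 0) l) (fun i => z i.succ))) := by
  induction l generalizing F with
  | nil =>
    convert hF using 2 with z
    congr 1
    funext i
    refine Fin.cases ?_ (fun i => ?_) i <;> simp [cbrFold]
  | cons a l ih => exact ih (cbr_min hF a)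

/-- Properties of the boundary-distance gadget
`g x = min_i min(ReLU(x i), ReLU(1 − x i))`: it is nonnegative, vanishes
outside the unit cube, keeps `x 0 + g x` inside `[0,1]` on the cube, and the
input-manipulation map adding `g x` to the first coordinate is computed by a
ReLU network. -/
theorem boundary_distance_gadget (n : ℕ) (hn : 1 ≤ n)
    (g : (Fin n → ℝ) → ℝ)
    (hg : ∀ x : Fin n → ℝ,
      g x = ⨅ i : Fin n, min (max (x i) 0) (max (1 - x i) 0)) :
    (∀ x : Fin n → ℝ, 0 ≤ g x) ∧
    (∀ x : Fin n → ℝ, (∃ i, x i < 0 ∨ 1 < x i) → g x = 0) ∧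
    (∀ x : Fin n → ℝ, (∀ i, 0 ≤ x i ∧ x i ≤ 1) →
      0 ≤ x ⟨0, hn⟩ + g x ∧ x ⟨0, hn⟩ + g x ≤ 1) ∧
    ComputedByReLU n n
      (fun x => Function.update x ⟨0, hn⟩ (x ⟨0, hn⟩ + g x)) := by
  haveI : Nonempty (Fin n) := ⟨⟨0, hn⟩⟩
  have hbdd : ∀ x : Fin n → ℝ, BddBelow (Set.range
      fun i : Fin n => min (max (x i) 0) (max (1 - x i) 0)) :=
    fun x => (Set.finite_range _).bddBelow
  have hle : ∀ (x : Fin n → ℝ) (i : Fin n), g x ≤ min (max (x i) 0) (max (1 - x i) 0) := by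
    intro x i
    rw [hg]
    exact ciInf_le (hbdd x) i
  have h0 : ∀ x : Fin n → ℝ, 0 ≤ g x := by
    intro x
    rw [hg]
    exact le_ciInf fun i => le_min (le_max_right _ _) (le_max_right _ _)
  refine ⟨h0, ?_, ?_, ?_⟩
  · rintro x ⟨i, hi⟩
    refine le_antisymm ((hle x i).trans ?_) (h0 x)
    rcases hi with hi | hi
    · exact (min_le_left _ _).trans (max_le hi.le le_rfl)
    · exact (min_le_right _ _).trans (max_le (by linarith) le_rfl)
  · intro x hx
    have h1 := h0 x
    have h2 := (hle x ⟨0, hn⟩).trans (min_le_right _ _)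
    have h3 := hx ⟨0, hn⟩
    rw [max_eq_left (by linarith)] at h2
    constructor <;> linarith
  · have hgf : ∀ x : Fin n → ℝ,
        g x = max (cbrFold x (x ⟨0, hn⟩) (List.finRange n)) 0 := by
      intro x
      apply le_antisymm
      · rcases (h0 x).eq_or_lt with h | h
        · rw [← h]; exact le_max_right _ _
        · refine le_trans ?_ (le_max_left _ _)
          have hh : ∀ i, g x ≤ x i ∧ g x ≤ 1 - x i := by
            intro i
            have h4 := le_min_iff.1 (hle x i)
            rw [le_max_iff, le_max_iff] at h4
            exact ⟨h4.1.resolve_right (not_le.2 h), h4.2.resolve_right (not_le.2 h)⟩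
          exact (le_cbrFold _ _ _ _).2 ⟨(hh _).1, fun i _ => hh i⟩
      · rw [hg]
        refine le_ciInf fun i => ?_
        have h5 := ((le_cbrFold _ _ _ _).1
          (le_refl (cbrFold x (x ⟨0, hn⟩) (List.finRange n)))).2 i (List.mem_finRange i)
        exact le_min (max_le_max h5.1 le_rfl) (max_le_max h5.2 le_rfl)
    have a1 := ComputedByReLU.affine (n := n + 1) (m := n)
      (fun i => Fin.cons (if i = ⟨0, hn⟩ then 1 else 0) (fun j => if i = j then 1 else 0))
      (fun _ => 0)
    have a2 := cbr_step a1 1 (fun _ => 0) (-1) 0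
    have a3 := cbr_fold (List.finRange n) a2
    have a4 := cbr_comp_affine a3 (n := n)
      (Fin.cons (fun j => if ⟨0, hn⟩ = j then 1 else 0) (fun i j => if i = j then 1 else 0))
      (fun _ => 0)
    convert a4 using 2 with x
    funext i
    simp only [Fin.sum_univ_succ, Fin.cons_zero, Fin.cons_succ, apply_ite (Rat.cast : ℚ → ℝ),
      ite_mul, Finset.sum_ite_eq, Finset.mem_univ, if_true, Rat.cast_one, Rat.cast_zero,
      Rat.cast_neg, zero_mul, one_mul, neg_mul, add_zero, Finset.sum_const_zero]
    have key : ∀ a : ℝ, a + max (-a) 0 = max a 0 := by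
      intro a
      rcases le_total a 0 with h | h
      · rw [max_eq_right h, max_eq_left (by linarith)]; ring
      · rw [max_eq_left h, max_eq_right (by linarith)]; ring
    rw [key, ← hgf, Function.update_apply]
    split_ifs with h
    · subst h; ring
    · ring
end
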